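/- arXiv:0810.2076 — 6 statements merged into one kernel-verified Lean document; each statement's English description precedes it below -/
import Mathlib

section
/- Let K be an algebraically closed field, n ≥ 1, and μ = (μ^1,…,μ^k) a k-tuple of partitions of n. Let d be the greatest common divisor of all the parts μ^i_j. If the characteristic of K does not divide d, then there exists a generic k-tuple (C_1,…,C_k) of semisimple conjugacy classes of GL_n(K) of type μ (in particular satisfying ∏_{i=1}^k det(C_i) = 1). -/
open Matrix

/-- A square matrix `X` over `K` has (semisimple) type `μ : Fin r → ℕ` if it is
diagonalizable with exactly `r` distinct eigenvalues whose multiplicities are the `μ j`. -/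
def Matrix.HasSSType {K : Type*} [Field K] {n r : ℕ}
    (μ : Fin r → ℕ) (X : Matrix (Fin n) (Fin n) K) : Prop :=
  ∃ (P : GL (Fin n) K) (d : Fin n → K) (a : Fin r → K),
    Function.Injective a ∧
    X = (P : Matrix (Fin n) (Fin n) K) * Matrix.diagonal d * ((P⁻¹ : GL (Fin n) K) : Matrix (Fin n) (Fin n) K) ∧
    (Finset.univ.val.map d) = ∑ j : Fin r, Multiset.replicate (μ j) (a j)

/-- `C` is the conjugacy class of a semisimple matrix of type `μ`. -/
def IsSSConjClassOfType {K : Type*} [Field K] {n r : ℕ}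
    (μ : Fin r → ℕ) (C : Set (Matrix (Fin n) (Fin n) K)) : Prop :=
  ∃ X : Matrix (Fin n) (Fin n) K, Matrix.HasSSType μ X ∧
    C = {Y | ∃ P : GL (Fin n) K,
      Y = (P : Matrix (Fin n) (Fin n) K) * X * ((P⁻¹ : GL (Fin n) K) : Matrix (Fin n) (Fin n) K)}

/-- Genericity of a tuple of conjugacy classes: whenever a subspace `V ⊆ K^n` is stable
under some `X i ∈ C i` for each `i` and the product of the determinants of the restrictions
is `1`, then `V = 0` or `V = K^n`. -/
def IsGenericTuple {K : Type*} [Field K] {n k : ℕ}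
    (C : Fin k → Set (Matrix (Fin n) (Fin n) K)) : Prop :=
  ∀ (V : Submodule K (Fin n → K)) (X : Fin k → Matrix (Fin n) (Fin n) K),
    (∀ i, X i ∈ C i) →
    ∀ hV : ∀ i, ∀ v ∈ V, (X i).mulVecLin v ∈ V,
    (∏ i, LinearMap.det ((X i).mulVecLin.restrict (hV i))) = 1 →
    V = ⊥ ∨ V = ⊤

section GenericTuple

open Polynomial

lemma exists_int_orthogonal_forall_ne_zero {ι σ : Type*} [Fintype ι] [Finite σ]
    (ν : ι → ℤ) (c : σ → ι → ℤ) (h : ∀ s, ∃ i j, c s i * ν j ≠ c s j * ν i) :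
    ∃ w : ι → ℤ, ∑ i, w i * ν i = 0 ∧ ∀ s, ∑ i, w i * c s i ≠ 0 := by
  classical
  let f (v : ι → ℤ) : (ι → ℚ) →ₗ[ℚ] ℚ := Fintype.linearCombination ℚ fun i => (v i : ℚ)
  have hf (v : ι → ℤ) (x : ι → ℚ) : f v x = ∑ i, x i * v i := by
    simp [f, Fintype.linearCombination_apply]
  have key : ∀ s, ∃ x ∈ LinearMap.ker (f ν), f (c s) x ≠ 0 := by
    intro s
    obtain ⟨i, j, hij⟩ := h s
    refine ⟨Pi.single i (ν j : ℚ) - Pi.single j (ν i : ℚ), ?_, ?_⟩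
    · simp only [LinearMap.mem_ker, hf, Pi.sub_apply, sub_mul, Finset.sum_sub_distrib]
      simp [Pi.single_apply, mul_comm]
    · simp only [hf, Pi.sub_apply, sub_mul, Finset.sum_sub_distrib]
      simp only [Pi.single_apply, ite_mul, zero_mul, Finset.sum_ite_eq', Finset.mem_univ, if_true]
      rw [sub_ne_zero, mul_comm, mul_comm (ν i : ℚ)]
      exact_mod_cast hij
  obtain ⟨x, hx, hxs⟩ :=
    Module.Dual.exists_forall_mem_ne_zero_of_forall_exists (LinearMap.ker (f ν))
      (fun s => f (c s)) key
  obtain ⟨b, hb⟩ := IsLocalization.exist_integer_multiples_of_finite (nonZeroDivisors ℤ) x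
  choose w hw using hb
  have hb0 : ((b : ℤ) : ℚ) ≠ 0 := by exact_mod_cast nonZeroDivisors.coe_ne_zero b
  have hw' (i : ι) : (w i : ℚ) = (b : ℤ) * x i := by simpa using hw i
  have hsum (v : ι → ℤ) : ((∑ i, w i * v i : ℤ) : ℚ) = (b : ℤ) * f v x := by
    push_cast
    rw [hf, Finset.mul_sum]
    exact Finset.sum_congr rfl fun i _ => by rw [hw', mul_assoc]
  refine ⟨w, ?_, fun s hs => ?_⟩
  · have := hsum ν
    rw [LinearMap.mem_ker.mp hx, mul_zero] at this
    exact_mod_cast this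
  · have := hsum (c s)
    rw [hs, Int.cast_zero] at this
    exact mul_ne_zero hb0 (hxs s) this.symm

lemma Units.finite_setOf_pow_eq {K : Type*} [Field K] {m : ℕ} (hm : 0 < m) (b : Kˣ) :
    {x : Kˣ | x ^ m = b}.Finite := by
  classical
  refine Set.Finite.of_finite_image (f := ((↑) : Kˣ → K))
    ((nthRootsFinset m (b : K)).finite_toSet.subset ?_) (Units.val_injective.injOn)
  rintro _ ⟨x, hx, rfl⟩
  rw [Finset.mem_coe, mem_nthRootsFinset hm]
  rw [← hx, Units.val_pow_eq_pow_val]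

lemma Units.finite_setOf_zpow_eq {K : Type*} [Field K] {m : ℤ} (hm : m ≠ 0) (b : Kˣ) :
    {x : Kˣ | x ^ m = b}.Finite := by
  have hm' : 0 < m.natAbs := Int.natAbs_pos.mpr hm
  rcases Int.natAbs_eq m with h | h
  · rw [h]
    simp_rw [zpow_natCast]
    exact Units.finite_setOf_pow_eq hm' b
  · rw [h]
    simp_rw [_root_.zpow_neg, zpow_natCast, inv_eq_iff_eq_inv]
    exact Units.finite_setOf_pow_eq hm' b⁻¹

lemma exists_units_prod_pow_eq_forall_prod_zpow_ne_one {K ι σ : Type*} [Field K] [IsAlgClosed K]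
    [Fintype ι] [Finite σ] (ν : ι → ℕ) (hν : ∃ i, ν i ≠ 0) (ζ : Kˣ) (c : σ → ι → ℤ)
    (h : ∀ s, ∃ i j, c s i * ν j ≠ c s j * ν i) :
    ∃ a : ι → Kˣ, ∏ i, a i ^ ν i = ζ ∧ ∀ s, ∏ i, a i ^ c s i ≠ 1 := by
  classical
  obtain ⟨w, hw, hws⟩ := exists_int_orthogonal_forall_ne_zero (fun i => (ν i : ℤ)) c h
  obtain ⟨i₀, hi₀⟩ := hν
  obtain ⟨z, hz⟩ := IsAlgClosed.exists_pow_nat_eq (ζ : K) (Nat.pos_of_ne_zero hi₀)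
  have hz0 : z ≠ 0 := by
    rintro rfl
    exact ζ.ne_zero (by rw [← hz, zero_pow hi₀])
  let b : ι → Kˣ := Pi.mulSingle i₀ (Units.mk0 z hz0)
  have hb : ∏ i, b i ^ ν i = ζ := by
    rw [Finset.prod_eq_single i₀ (fun j _ hj => by simp [b, hj]) (by simp)]
    ext
    simpa [b] using hz
  have hfin : (⋃ s, {x : Kˣ | x ^ (∑ i, w i * c s i) = (∏ i, b i ^ c s i)⁻¹}).Finite :=
    Set.finite_iUnion fun s => Units.finite_setOf_zpow_eq (hws s) _
  have : Infinite Kˣ :=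
    have : Infinite {a : K // a ≠ 0} := (Set.finite_singleton (0 : K)).infinite_compl.to_subtype
    Infinite.of_injective (unitsEquivNeZero (G₀ := K)).symm (Equiv.injective _)
  obtain ⟨x, hx⟩ := hfin.infinite_compl.nonempty
  have hprod (v : ι → ℤ) :
      ∏ i, (b i * x ^ w i) ^ v i = (∏ i, b i ^ v i) * x ^ (∑ i, w i * v i) := by
    simp_rw [mul_zpow, Finset.prod_mul_distrib, ← _root_.zpow_mul]
    congr 1
    exact (map_sum (zpowersHom Kˣ x).toAdditiveRight (fun i => w i * v i) Finset.univ).symm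
  refine ⟨fun i => b i * x ^ w i, ?_, fun s hs => hx ?_⟩
  · have := hprod fun i => (ν i : ℤ)
    simpa only [zpow_natCast, hw, zpow_zero, mul_one, hb] using this
  · rw [hprod] at hs
    exact Set.mem_iUnion.mpr ⟨s, eq_inv_of_mul_eq_one_right hs⟩

lemma exists_injective_units_forall_prod_pow_ne_one {K κ : Type*} [Field K] [IsAlgClosed K]
    [Fintype κ] [Nonempty κ] {n : ℕ} (hn : 1 ≤ n) (r : κ → ℕ) (μ : (i : κ) → Fin (r i) → ℕ)
    (hpos : ∀ i j, 0 < μ i j) (hsum : ∀ i, ∑ j, μ i j = n)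
    (hchar : ¬ (ringChar K ∣ Finset.univ.gcd (fun p : Σ i : κ, Fin (r i) => μ p.1 p.2))) :
    ∃ a : (i : κ) → Fin (r i) → Kˣ, (∀ i, Function.Injective (a i)) ∧
      ∏ i, ∏ j, a i j ^ μ i j = 1 ∧
      ∀ (m : (i : κ) → Fin (r i) → ℕ) (t : ℕ), (∀ i j, m i j ≤ μ i j) → 0 < t → t < n →
        (∀ i, ∑ j, m i j = t) → ∏ i, ∏ j, a i j ^ m i j ≠ 1 := by
  classical
  set d := Finset.univ.gcd (fun p : Σ i : κ, Fin (r i) => μ p.1 p.2) with hd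
  have : NeZero (d : K) := ⟨fun h => hchar ((ringChar.spec K d).mp h)⟩
  have : NeZero d := .of_neZero_natCast K
  have hd0 : 0 < d := NeZero.pos d
  obtain ⟨ζ₀, hζ₀⟩ := HasEnoughRootsOfUnity.exists_primitiveRoot K d
  obtain ⟨ζ, rfl⟩ := hζ₀.isUnit (NeZero.ne d)
  have hζ : IsPrimitiveRoot ζ d := IsPrimitiveRoot.coe_units_iff.mp hζ₀
  have hdvd (p : Σ i : κ, Fin (r i)) : d ∣ μ p.1 p.2 := Finset.gcd_dvd (Finset.mem_univ p)
  choose ν hν using hdvd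
  have hνpos (p : Σ i : κ, Fin (r i)) : 0 < ν p :=
    Nat.pos_of_ne_zero fun h => (hpos p.1 p.2).ne' (by rw [hν, h, mul_zero])
  have hne : ∃ p, ν p ≠ 0 := by
    obtain ⟨i⟩ := ‹Nonempty κ›
    have : Nonempty (Fin (r i)) := by
      by_contra hr
      rw [not_nonempty_iff] at hr
      have := hsum i
      simp at this
      omega
    obtain ⟨j⟩ := this
    exact ⟨⟨i, j⟩, (hνpos _).ne'⟩
  let M := {m : (p : Σ i : κ, Fin (r i)) → Fin (μ p.1 p.2 + 1) //
    ∃ p q, (m p : ℕ) * ν q ≠ (m q : ℕ) * ν p}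
  let D := {p : (Σ i : κ, Fin (r i)) × (Σ i : κ, Fin (r i)) // p.1 ≠ p.2}
  let c : M ⊕ D → (Σ i : κ, Fin (r i)) → ℤ :=
    Sum.elim (fun m p => (m.1 p : ℕ)) (fun q => Pi.single q.1.1 1 - Pi.single q.1.2 1)
  obtain ⟨a, ha, hac⟩ := exists_units_prod_pow_eq_forall_prod_zpow_ne_one ν hne ζ c <| by
    rintro (⟨m, p, q, hpq⟩ | ⟨⟨p, q⟩, hpq⟩)
    · exact ⟨p, q, by simp only [c, Sum.elim_inl]; exact_mod_cast hpq⟩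
    · refine ⟨p, q, ?_⟩
      have hp := hνpos p
      have hq := hνpos q
      have hpq' : p ≠ q := hpq
      simp [c, hpq', hpq'.symm]
      omega
  refine ⟨fun i j => a ⟨i, j⟩, fun i j j' hjj => ?_, ?_, fun m t hm ht htn hmt hprod => ?_⟩
  · by_contra hne'
    have hpq : (⟨i, j⟩ : Σ i : κ, Fin (r i)) ≠ ⟨i, j'⟩ := by simpa using hne'
    apply hac (Sum.inr ⟨(⟨i, j⟩, ⟨i, j'⟩), hpq⟩)
    simp only [c, Sum.elim_inr, Pi.sub_apply, _root_.zpow_sub, Finset.prod_mul_distrib,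
      Finset.prod_inv_distrib]
    rw [mul_inv_eq_one, Finset.prod_eq_single ⟨i, j⟩ (fun q _ hq => by simp [hq]) (by simp),
      Finset.prod_eq_single ⟨i, j'⟩ (fun q _ hq => by simp [hq]) (by simp)]
    simpa using hjj
  · rw [← Fintype.prod_sigma' (fun i j => a ⟨i, j⟩ ^ μ i j)]
    simp_rw [hν, mul_comm d, pow_mul]
    rw [Finset.prod_pow, ha, hζ.pow_eq_one]
  · rw [← Fintype.prod_sigma' (fun i j => a ⟨i, j⟩ ^ m i j)] at hprod
    by_cases hprop : ∃ p q : Σ i : κ, Fin (r i), m p.1 p.2 * ν q ≠ m q.1 q.2 * ν p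
    · refine hac (Sum.inl ⟨fun p => ⟨m p.1 p.2, Nat.lt_succ_of_le (hm _ _)⟩, hprop⟩) ?_
      simpa [c] using hprod
    · push Not at hprop
      have hmn (p : Σ i : κ, Fin (r i)) : m p.1 p.2 * n = t * μ p.1 p.2 := by
        rw [← hsum p.1, ← hmt p.1, Finset.mul_sum, Finset.sum_mul]
        refine Finset.sum_congr rfl fun j _ => ?_
        have := hprop p ⟨p.1, j⟩
        rw [hν p, hν ⟨p.1, j⟩]
        linear_combination d * this
      have hdn : d ∣ n := by
        obtain ⟨i⟩ := ‹Nonempty κ›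
        rw [← hsum i]
        exact Finset.dvd_sum fun j _ => ⟨_, hν ⟨i, j⟩⟩
      have hntd : n ∣ t * d := by
        rw [hd, ← normalize_eq t, ← Finset.gcd_mul_left]
        exact Finset.dvd_gcd fun p _ => ⟨m p.1 p.2, by rw [← hmn, mul_comm]⟩
      obtain ⟨e, he⟩ := hdn
      have he0 : 0 < e := Nat.pos_of_ne_zero fun h => by simp [h] at he; omega
      obtain ⟨s, hs⟩ : e ∣ t := by
        rw [he, mul_comm] at hntd
        exact Nat.dvd_of_mul_dvd_mul_right hd0 hntd
      have hms (p : Σ i : κ, Fin (r i)) : m p.1 p.2 = ν p * s := by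
        have := hmn p
        rw [hν p, hs, he] at this
        refine Nat.eq_of_mul_eq_mul_right (Nat.mul_pos hd0 he0) ?_
        linear_combination this
      simp_rw [hms, pow_mul] at hprod
      rw [Finset.prod_pow, ha, hζ.pow_eq_one_iff_dvd] at hprod
      have hs0 : 0 < s := Nat.pos_of_ne_zero fun h => by simp [h] at hs; omega
      have := Nat.le_of_dvd hs0 hprod
      have : n ≤ t := by rw [he, hs, mul_comm e]; exact Nat.mul_le_mul_right e this
      omega

lemma LinearMap.roots_charpoly_restrict_le {K E : Type*} [Field K] [AddCommGroup E] [Module K E]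
    [FiniteDimensional K E] (f : Module.End K E) (V : Submodule K E) (hV : ∀ v ∈ V, f v ∈ V) :
    (f.restrict hV).charpoly.roots ≤ f.charpoly.roots := by
  classical
  rw [Multiset.le_iff_count]
  intro x
  rw [count_roots, count_roots, ← LinearMap.finrank_maxGenEigenspace_eq,
    ← LinearMap.finrank_maxGenEigenspace_eq, Module.End.maxGenEigenspace,
    Module.End.genEigenspace_restrict, ← Submodule.finrank_map_subtype_eq]
  exact Submodule.finrank_mono (Submodule.map_comap_le _ _)

lemma Multiset.eq_sum_replicate_count {α ι : Type*} [DecidableEq α] [Fintype ι] {a : ι → α}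
    (ha : Function.Injective a) {μ : ι → ℕ} {s : Multiset α}
    (hs : s ≤ ∑ j, replicate (μ j) (a j)) :
    (∀ j, s.count (a j) ≤ μ j) ∧ s = ∑ j, replicate (s.count (a j)) (a j) := by
  classical
  have hcount (m : ι → ℕ) (j : ι) : (∑ l, replicate (m l) (a l)).count (a j) = m j := by
    simp [Multiset.count_sum', Multiset.count_replicate, ha.eq_iff]
  refine ⟨fun j => (Multiset.count_le_of_le _ hs).trans_eq (hcount μ j), ?_⟩
  ext x
  by_cases hx : ∃ j, a j = x
  · obtain ⟨j, rfl⟩ := hx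
    rw [hcount]
  · push Not at hx
    have h0 (m : ι → ℕ) : (∑ l, replicate (m l) (a l)).count x = 0 := by
      simp [Multiset.count_sum', Multiset.count_replicate, hx]
    rw [h0]
    exact Nat.le_zero.mp ((Multiset.count_le_of_le _ hs).trans_eq (h0 μ))

lemma Multiset.exists_univ_map_eq {α : Type*} {n : ℕ} (s : Multiset α) (hs : s.card = n) :
    ∃ f : Fin n → α, Finset.univ.val.map f = s := by
  subst hs
  refine ⟨fun i => s.toList.get (i.cast s.length_toList.symm), ?_⟩
  conv_rhs => rw [← s.coe_toList, ← List.ofFn_get s.toList, List.ofFn_congr s.length_toList]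
  exact Fin.univ_val_map _

lemma Matrix.roots_charpoly_diagonal {K ι : Type*} [Field K] [Fintype ι] [DecidableEq ι]
    (d : ι → K) : (Matrix.diagonal d).charpoly.roots = Finset.univ.val.map d := by
  rw [Matrix.charpoly_diagonal]
  simpa [Multiset.map_map] using roots_multiset_prod_X_sub_C (Finset.univ.val.map d)

end GenericTuple

/-- **Existence of generic tuples of semisimple conjugacy classes** (Lemma 2.1.2).
If the characteristic of the algebraically closed field `K` does not divide the gcd `d` of
all the parts `μ i j` of the `k`-tuple of partitions `μ` of `n`, then there is a generic
`k`-tuple of semisimple conjugacy classes of `GL_n(K)` of type `μ`; in particular the product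
of the determinants over the tuple equals `1`. -/
theorem exists_generic_tuple_of_conjugacy_classes
    (K : Type*) [Field K] [IsAlgClosed K]
    (n k : ℕ) (hn : 1 ≤ n) (hk : 1 ≤ k)
    (r : Fin k → ℕ) (μ : (i : Fin k) → Fin (r i) → ℕ)
    (hpos : ∀ i j, 0 < μ i j) (hsum : ∀ i, ∑ j, μ i j = n)
    (hchar : ¬ (ringChar K ∣ Finset.univ.gcd (fun p : Σ i : Fin k, Fin (r i) => μ p.1 p.2))) :
    ∃ C : Fin k → Set (Matrix (Fin n) (Fin n) K),
      (∀ i, IsSSConjClassOfType (μ i) (C i)) ∧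
      (∀ X : Fin k → Matrix (Fin n) (Fin n) K,
          (∀ i, X i ∈ C i) → ∏ i, (X i).det = 1) ∧
      IsGenericTuple C := by
  classical
  have : Nonempty (Fin k) := ⟨⟨0, hk⟩⟩
  obtain ⟨a, ha, ha1, hane⟩ :=
    exists_injective_units_forall_prod_pow_ne_one hn r μ hpos hsum hchar
  have hd (i : Fin k) : ∃ d : Fin n → K,
      Finset.univ.val.map d = ∑ j, Multiset.replicate (μ i j) (a i j : K) :=
    Multiset.exists_univ_map_eq _ (by simp [hsum])
  choose d hd using hd
  have hinj (i : Fin k) : Function.Injective fun j => (a i j : K) :=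
    Units.val_injective.comp (ha i)
  let C (i : Fin k) : Set (Matrix (Fin n) (Fin n) K) :=
    {Y | ∃ P : GL (Fin n) K, Y = P * Matrix.diagonal (d i) * (P⁻¹ : GL (Fin n) K)}
  have hroots (i : Fin k) (Y) (hY : Y ∈ C i) :
      Y.charpoly.roots = ∑ j, Multiset.replicate (μ i j) (a i j : K) := by
    obtain ⟨P, rfl⟩ := hY
    rw [Matrix.coe_units_inv, Matrix.charpoly_units_conj, Matrix.roots_charpoly_diagonal, hd]
  refine ⟨C, fun i => ⟨Matrix.diagonal (d i), ⟨1, d i, _, hinj i, by simp, hd i⟩, rfl⟩,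
    fun X hX => ?_, fun V X hX hV hdet => ?_⟩
  · have hdet (i : Fin k) : (X i).det = ((∏ j, a i j ^ μ i j : Kˣ) : K) := by
      rw [Matrix.det_eq_prod_roots_charpoly, hroots i _ (hX i)]
      simp [Multiset.prod_sum]
    simp_rw [hdet]
    rw [← Units.coe_prod, ha1, Units.val_one]
  · let s (i : Fin k) : Multiset K := ((X i).mulVecLin.restrict (hV i)).charpoly.roots
    have hs (i : Fin k) : s i ≤ ∑ j, Multiset.replicate (μ i j) (a i j : K) := by
      rw [← hroots i _ (hX i), ← Matrix.charpoly_mulVecLin]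
      exact LinearMap.roots_charpoly_restrict_le _ V (hV i)
    have hcard (i : Fin k) : (s i).card = Module.finrank K V := by
      rw [← LinearMap.charpoly_natDegree ((X i).mulVecLin.restrict (hV i))]
      exact Polynomial.splits_iff_card_roots.mp (IsAlgClosed.splits _)
    by_contra! hV'
    have hs' i := Multiset.eq_sum_replicate_count (hinj i) (hs i)
    refine hane (fun i j => (s i).count (a i j : K)) (Module.finrank K V) (fun i => (hs' i).1)
      (Nat.pos_of_ne_zero fun h => hV'.1 (Submodule.finrank_eq_zero.mp h)) ?_ (fun i => ?_) ?_
    · simpa using Submodule.finrank_lt hV'.2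
    · rw [← hcard i]
      conv_rhs => rw [(hs' i).2]
      simp
    · have hdet' (i : Fin k) : LinearMap.det ((X i).mulVecLin.restrict (hV i)) =
          ((∏ j, a i j ^ (s i).count (a i j : K) : Kˣ) : K) := by
        rw [Module.End.det_eq_prod_roots_charpoly_of_splits (IsAlgClosed.splits _)]
        change (s i).prod = _
        conv_lhs => rw [(hs' i).2]
        simp [Multiset.prod_sum]
      simp_rw [hdet'] at hdet
      rwa [← Units.coe_prod, Units.val_eq_one] at hdet
end

section
/- Let (C_1,…,C_k) be a generic k-tuple of semisimple conjugacy classes of GL_n(K) of type μ. Suppose A_1,B_1,…,A_g,B_g ∈ GL_n(K) and X_i ∈ C_i satisfy (A_1,B_1)(A_2,B_2)⋯(A_g,B_g) X_1 X_2 ⋯ X_k = I_n, where (A,B) := ABA⁻¹B⁻¹. Then: (a) the only K-subspaces of K^n invariant under all of A_1,B_1,…,A_g,B_g,X_1,…,X_k are 0 and K^n; (b) every h ∈ GL_n(K) commuting with all of A_1,B_1,…,A_g,B_g,X_1,…,X_k is a scalar matrix. Consequently PGL_n(K) acts set-theoretically freely on the set of such solutions. -/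
open Matrix

/-- The matrices whose action on column vectors preserves the subspace `V`. -/
def Matrix.stabilizingSubmonoid {K : Type*} [Field K] {n : ℕ} (V : Submodule K (Fin n → K)) :
    Submonoid (Matrix (Fin n) (Fin n) K) where
  carrier := {M | ∀ v ∈ V, M.mulVecLin v ∈ V}
  one_mem' := by simp
  mul_mem' := by
    intro M N hM hN v hv
    rw [Matrix.mulVecLin_mul]
    exact hM _ (hN v hv)

/-- The determinant of the restriction to `V`, as a monoid homomorphism on the matrices
preserving `V`. -/
noncomputable def Matrix.detRestrict {K : Type*} [Field K] {n : ℕ}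
    (V : Submodule K (Fin n → K)) : Matrix.stabilizingSubmonoid V →* K where
  toFun M := LinearMap.det (M.1.mulVecLin.restrict M.2)
  map_one' := by
    convert LinearMap.det_id (A := K) (M := V) using 2
    ext v
    simp
  map_mul' M N := by
    rw [← LinearMap.det_comp]
    congr 1
    ext1 v
    exact Subtype.ext (Matrix.mulVec_mulVec v.1 M.1 N.1).symm

theorem Matrix.inv_mem_stabilizingSubmonoid {K : Type*} [Field K] {n : ℕ}
    {V : Submodule K (Fin n → K)} {A : GL (Fin n) K}
    (hA : (A : Matrix (Fin n) (Fin n) K) ∈ Matrix.stabilizingSubmonoid V) :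
    ((A⁻¹ : GL (Fin n) K) : Matrix (Fin n) (Fin n) K) ∈ Matrix.stabilizingSubmonoid V := by
  have hinj : Function.Injective ((A : Matrix (Fin n) (Fin n) K).mulVecLin.restrict hA) := by
    intro v w hvw
    have h : (A⁻¹ : GL (Fin n) K).1 *ᵥ (A.1 *ᵥ v.1) = (A⁻¹ : GL (Fin n) K).1 *ᵥ (A.1 *ᵥ w.1) :=
      congrArg (fun u : V => (A⁻¹ : GL (Fin n) K).1 *ᵥ u.1) hvw
    simpa only [Matrix.mulVec_mulVec, ← Units.val_mul, inv_mul_cancel, Units.val_one,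
      Matrix.one_mulVec, SetLike.coe_eq_coe] using h
  intro v hv
  obtain ⟨w, hw⟩ := LinearMap.injective_iff_surjective.mp hinj ⟨v, hv⟩
  have hw' : v = (A : Matrix (Fin n) (Fin n) K) *ᵥ w.1 := (congrArg Subtype.val hw).symm
  have : (A⁻¹ : GL (Fin n) K).1 *ᵥ v = w.1 := by
    rw [hw', Matrix.mulVec_mulVec, ← Units.val_mul, inv_mul_cancel, Units.val_one,
      Matrix.one_mulVec]
  rw [Matrix.mulVecLin_apply, this]
  exact w.2

theorem Matrix.prod_detRestrict_eq_one {K : Type*} [Field K] {n g k : ℕ}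
    {V : Submodule K (Fin n → K)} {A B : Fin g → GL (Fin n) K}
    {X : Fin k → Matrix (Fin n) (Fin n) K}
    (hA : ∀ j, (A j : Matrix (Fin n) (Fin n) K) ∈ Matrix.stabilizingSubmonoid V)
    (hB : ∀ j, (B j : Matrix (Fin n) (Fin n) K) ∈ Matrix.stabilizingSubmonoid V)
    (hX : ∀ i, X i ∈ Matrix.stabilizingSubmonoid V)
    (heq : (List.ofFn (fun j => ((A j : Matrix (Fin n) (Fin n) K) *
        (B j : Matrix (Fin n) (Fin n) K) *
        (((A j)⁻¹ : GL (Fin n) K) : Matrix (Fin n) (Fin n) K) *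
        (((B j)⁻¹ : GL (Fin n) K) : Matrix (Fin n) (Fin n) K)))).prod *
      (List.ofFn X).prod = 1) :
    ∏ i, Matrix.detRestrict V ⟨X i, hX i⟩ = 1 := by
  let S := Matrix.stabilizingSubmonoid V
  let a (j : Fin g) : S := ⟨_, hA j⟩
  let b (j : Fin g) : S := ⟨_, hB j⟩
  let a' (j : Fin g) : S := ⟨_, Matrix.inv_mem_stabilizingSubmonoid (hA j)⟩
  let b' (j : Fin g) : S := ⟨_, Matrix.inv_mem_stabilizingSubmonoid (hB j)⟩
  let x (i : Fin k) : S := ⟨X i, hX i⟩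
  have ha (j : Fin g) : a j * a' j = 1 := Subtype.ext (A j).mul_inv
  have hb (j : Fin g) : b j * b' j = 1 := Subtype.ext (B j).mul_inv
  have hS : (List.ofFn fun j => a j * b j * a' j * b' j).prod * (List.ofFn x).prod = 1 := by
    apply Subtype.ext
    rw [Submonoid.coe_mul, Submonoid.coe_list_prod, Submonoid.coe_list_prod, List.map_ofFn,
      List.map_ofFn]
    exact heq
  have hcomm (j : Fin g) : Matrix.detRestrict V (a j * b j * a' j * b' j) = 1 := by
    have h₁ := congrArg (Matrix.detRestrict V) (ha j)
    have h₂ := congrArg (Matrix.detRestrict V) (hb j)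
    simp only [map_mul, map_one] at h₁ h₂ ⊢
    linear_combination
      (Matrix.detRestrict V (b j) * Matrix.detRestrict V (b' j)) * h₁ + h₂
  have h := congrArg (Matrix.detRestrict V) hS
  rw [map_mul, map_list_prod, map_list_prod, List.map_ofFn, List.map_ofFn, List.prod_ofFn,
    List.prod_ofFn, map_one] at h
  simp only [Function.comp_apply, hcomm, Finset.prod_const_one, one_mul] at h
  exact h

/-- Schur's lemma: a matrix commuting with a family of matrices without nontrivial common
invariant subspaces is scalar. -/
theorem Matrix.eq_smul_one_of_commute_of_irreducible {K : Type*} [Field K] [IsAlgClosed K]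
    {n : ℕ} (hn : 1 ≤ n) {s : Set (Matrix (Fin n) (Fin n) K)}
    (hirr : ∀ V : Submodule K (Fin n → K),
      (∀ M ∈ s, ∀ v ∈ V, M.mulVecLin v ∈ V) → V = ⊥ ∨ V = ⊤)
    {H : Matrix (Fin n) (Fin n) K} (hH : ∀ M ∈ s, H * M = M * H) :
    ∃ c : K, H = c • (1 : Matrix (Fin n) (Fin n) K) := by
  have : NeZero n := ⟨by omega⟩
  obtain ⟨c, hc⟩ := Module.End.exists_eigenvalue (K := K) (V := Fin n → K) H.mulVecLin
  refine ⟨c, ?_⟩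
  have htop : Module.End.eigenspace H.mulVecLin c = ⊤ := by
    refine (hirr _ fun M hM v hv => ?_).resolve_left hc
    rw [Module.End.mem_eigenspace_iff, Matrix.mulVecLin_apply] at hv ⊢
    rw [Matrix.mulVecLin_apply, Matrix.mulVec_mulVec, hH M hM, ← Matrix.mulVec_mulVec, hv,
      Matrix.mulVec_smul]
  apply Matrix.ext_of_mulVec_single
  intro i
  have hi : Pi.single i (1 : K) ∈ Module.End.eigenspace H.mulVecLin c := htop ▸ Submodule.mem_top
  rw [Module.End.mem_eigenspace_iff, Matrix.mulVecLin_apply] at hi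
  rw [hi, Matrix.smul_mulVec, Matrix.one_mulVec]

/-- **Proposition 2.1.4.** If `(C_1, …, C_k)` is a generic `k`-tuple of semisimple conjugacy
classes of `GL_n(K)` of type `μ`, and `A_1, B_1, …, A_g, B_g ∈ GL_n(K)` and `X_i ∈ C_i` satisfy
`(A_1,B_1) ⋯ (A_g,B_g) X_1 ⋯ X_k = 1` (with `(A,B) = A B A⁻¹ B⁻¹`), then (a) the only subspaces
of `K^n` invariant under all of the matrices are `0` and `K^n`, and (b) any `h ∈ GL_n(K)`
commuting with all of them is a scalar matrix; hence `PGL_n(K)` acts set-theoretically freely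
on the set of such solutions. -/
theorem generic_solutions_irreducible_and_scalar_centralizer
    (K : Type*) [Field K] [IsAlgClosed K]
    (n g k : ℕ) (hn : 1 ≤ n)
    (r : Fin k → ℕ) (μ : (i : Fin k) → Fin (r i) → ℕ)
    (hpos : ∀ i j, 0 < μ i j) (hsum : ∀ i, ∑ j, μ i j = n)
    (C : Fin k → Set (Matrix (Fin n) (Fin n) K))
    (hC : ∀ i, IsSSConjClassOfType (μ i) (C i))
    (hdet : ∀ Y : Fin k → Matrix (Fin n) (Fin n) K,
        (∀ i, Y i ∈ C i) → ∏ i, (Y i).det = 1)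
    (hgen : IsGenericTuple C)
    (A B : Fin g → GL (Fin n) K) (X : Fin k → Matrix (Fin n) (Fin n) K)
    (hX : ∀ i, X i ∈ C i)
    (heq : (List.ofFn (fun j => ((A j : Matrix (Fin n) (Fin n) K) * (B j : Matrix (Fin n) (Fin n) K) *
              (((A j)⁻¹ : GL (Fin n) K) : Matrix (Fin n) (Fin n) K) *
              (((B j)⁻¹ : GL (Fin n) K) : Matrix (Fin n) (Fin n) K)))).prod *
          (List.ofFn X).prod = 1) :
    (∀ V : Submodule K (Fin n → K),
        (∀ j, ∀ v ∈ V, ((A j : Matrix (Fin n) (Fin n) K)).mulVecLin v ∈ V) →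
        (∀ j, ∀ v ∈ V, ((B j : Matrix (Fin n) (Fin n) K)).mulVecLin v ∈ V) →
        (∀ i, ∀ v ∈ V, (X i).mulVecLin v ∈ V) →
        V = ⊥ ∨ V = ⊤) ∧
    (∀ h : GL (Fin n) K,
        (∀ j, (h : Matrix (Fin n) (Fin n) K) * (A j : Matrix (Fin n) (Fin n) K)
            = (A j : Matrix (Fin n) (Fin n) K) * (h : Matrix (Fin n) (Fin n) K)) →
        (∀ j, (h : Matrix (Fin n) (Fin n) K) * (B j : Matrix (Fin n) (Fin n) K)
            = (B j : Matrix (Fin n) (Fin n) K) * (h : Matrix (Fin n) (Fin n) K)) →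
        (∀ i, (h : Matrix (Fin n) (Fin n) K) * X i = X i * (h : Matrix (Fin n) (Fin n) K)) →
        ∃ c : K, (h : Matrix (Fin n) (Fin n) K) = c • (1 : Matrix (Fin n) (Fin n) K)) := by
  have hirr (V : Submodule K (Fin n → K))
      (hA : ∀ j, ∀ v ∈ V, ((A j : Matrix (Fin n) (Fin n) K)).mulVecLin v ∈ V)
      (hB : ∀ j, ∀ v ∈ V, ((B j : Matrix (Fin n) (Fin n) K)).mulVecLin v ∈ V)
      (hV : ∀ i, ∀ v ∈ V, (X i).mulVecLin v ∈ V) : V = ⊥ ∨ V = ⊤ :=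
    hgen V X hX hV (Matrix.prod_detRestrict_eq_one hA hB hV heq)
  refine ⟨hirr, fun h hA hB hX => ?_⟩
  apply Matrix.eq_smul_one_of_commute_of_irreducible hn
    (s := (Set.range fun j => (A j).1) ∪ (Set.range fun j => (B j).1) ∪ Set.range X)
  · intro V hV
    exact hirr V (fun j => hV _ (.inl (.inl ⟨j, rfl⟩))) (fun j => hV _ (.inl (.inr ⟨j, rfl⟩)))
      (fun i => hV _ (.inr ⟨i, rfl⟩))
  · rintro M ((⟨j, rfl⟩ | ⟨j, rfl⟩) | ⟨i, rfl⟩)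
    exacts [hA j, hB j, hX i]
end

section
/- Let (O_1,…,O_k) be a generic k-tuple of semisimple adjoint orbits of gl_n(K) of type μ. Suppose A_1,B_1,…,A_g,B_g ∈ gl_n(K) and X_i ∈ O_i satisfy [A_1,B_1]+[A_2,B_2]+⋯+[A_g,B_g]+X_1+⋯+X_k = 0, where [A,B] := AB − BA. Then: (a) there is no nonzero proper K-subspace of K^n invariant under all of A_1,B_1,…,A_g,B_g,X_1,…,X_k; (b) every h ∈ GL_n(K) with hA_jh⁻¹ = A_j, hB_jh⁻¹ = B_j and hX_ih⁻¹ = X_i for all i,j is a scalar matrix. Consequently PGL_n(K) acts set-theoretically freely on the set of such solutions. -/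
open Matrix

/-- `O` is the adjoint orbit (conjugation orbit) of a semisimple matrix of type `μ`. -/
def IsSSAdjOrbitOfType {K : Type*} [Field K] {n r : ℕ}
    (μ : Fin r → ℕ) (O : Set (Matrix (Fin n) (Fin n) K)) : Prop :=
  ∃ X : Matrix (Fin n) (Fin n) K, Matrix.HasSSType μ X ∧
    O = {Y | ∃ P : GL (Fin n) K,
      Y = (P : Matrix (Fin n) (Fin n) K) * X * ((P⁻¹ : GL (Fin n) K) : Matrix (Fin n) (Fin n) K)}

/-- Genericity of a tuple of adjoint orbits. -/
def IsGenericAdjTuple {K : Type*} [Field K] {n k : ℕ}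
    (O : Fin k → Set (Matrix (Fin n) (Fin n) K)) : Prop :=
  ∀ (V : Submodule K (Fin n → K)) (X : Fin k → Matrix (Fin n) (Fin n) K),
    (∀ i, X i ∈ O i) →
    ∀ hV : ∀ i, ∀ v ∈ V, (X i).mulVecLin v ∈ V,
    (∑ i, LinearMap.trace K V ((X i).mulVecLin.restrict (hV i))) = 0 →
    V = ⊥ ∨ V = ⊤

/-- If `∑ [A j, B j] + ∑ X i = 0` and all these endomorphisms preserve `V`, then the traces of the
restrictions of the `X i` to `V` sum to zero. -/
theorem LinearMap.sum_trace_restrict_eq_zero_of_sum_commutator_add_sum_eq_zero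
    {R M ι κ : Type*} [CommRing R] [AddCommGroup M] [Module R M] [Fintype ι] [Fintype κ]
    {A B : ι → Module.End R M} {X : κ → Module.End R M}
    (heq : (∑ j, (A j * B j - B j * A j)) + ∑ i, X i = 0) (V : Submodule R M)
    (hA : ∀ j, ∀ v ∈ V, A j v ∈ V) (hB : ∀ j, ∀ v ∈ V, B j v ∈ V)
    (hX : ∀ i, ∀ v ∈ V, X i v ∈ V) :
    ∑ i, LinearMap.trace R V ((X i).restrict (hX i)) = 0 := by
  have key : (∑ j, ((A j).restrict (hA j) * (B j).restrict (hB j) -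
      (B j).restrict (hB j) * (A j).restrict (hA j))) + ∑ i, (X i).restrict (hX i) = 0 := by
    ext v
    simpa [LinearMap.sum_apply] using LinearMap.congr_fun heq (v : M)
  simpa [map_add, map_sum, map_sub, LinearMap.trace_mul_comm] using
    congrArg (LinearMap.trace R V) key

/-- Schur's lemma: over an algebraically closed field, an endomorphism commuting with a set of
endomorphisms without common nontrivial invariant subspaces is a scalar. -/
theorem Module.End.exists_eq_smul_one_of_forall_commute
    {K M : Type*} [Field K] [IsAlgClosed K] [AddCommGroup M] [Module K M]
    [FiniteDimensional K M] [Nontrivial M] {S : Set (Module.End K M)}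
    (hS : ∀ V : Submodule K M, (∀ f ∈ S, ∀ v ∈ V, f v ∈ V) → V = ⊥ ∨ V = ⊤)
    {h : Module.End K M} (hcomm : ∀ f ∈ S, Commute h f) :
    ∃ c : K, h = c • (1 : Module.End K M) := by
  obtain ⟨c, hc⟩ := Module.End.exists_eigenvalue h
  refine ⟨c, ?_⟩
  have htop : h.eigenspace c = ⊤ := by
    refine (hS _ fun f hf v hv => ?_).resolve_left hc
    rw [Module.End.mem_eigenspace_iff] at hv ⊢
    rw [← Module.End.mul_apply, (hcomm f hf).eq, Module.End.mul_apply, hv, map_smul]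
  ext v
  have hv : v ∈ h.eigenspace c := htop ▸ Submodule.mem_top
  simpa using Module.End.mem_eigenspace_iff.mp hv

/-- **Proposition 2.2.3.** If `(O_1, …, O_k)` is a generic `k`-tuple of semisimple adjoint
orbits of `gl_n(K)` of type `μ`, and `A_1, B_1, …, A_g, B_g ∈ gl_n(K)` together with `X_i ∈ O_i`
satisfy `[A_1,B_1] + ⋯ + [A_g,B_g] + X_1 + ⋯ + X_k = 0`, then (a) there is no nonzero proper
subspace of `K^n` invariant under all of the matrices, and (b) any `h ∈ GL_n(K)` whose
conjugation action fixes all of them is a scalar matrix; hence `PGL_n(K)` acts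
set-theoretically freely on the set of such solutions. -/
theorem generic_adjoint_solutions_irreducible_and_scalar_centralizer
    (K : Type*) [Field K] [IsAlgClosed K]
    (n g k : ℕ) (hn : 1 ≤ n)
    (r : Fin k → ℕ) (μ : (i : Fin k) → Fin (r i) → ℕ)
    (hpos : ∀ i j, 0 < μ i j) (hsum : ∀ i, ∑ j, μ i j = n)
    (O : Fin k → Set (Matrix (Fin n) (Fin n) K))
    (hO : ∀ i, IsSSAdjOrbitOfType (μ i) (O i))
    (htr : ∀ Y : Fin k → Matrix (Fin n) (Fin n) K,
        (∀ i, Y i ∈ O i) → ∑ i, (Y i).trace = 0)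
    (hgen : IsGenericAdjTuple O)
    (A B : Fin g → Matrix (Fin n) (Fin n) K) (X : Fin k → Matrix (Fin n) (Fin n) K)
    (hX : ∀ i, X i ∈ O i)
    (heq : (∑ j, (A j * B j - B j * A j)) + ∑ i, X i = 0) :
    (∀ V : Submodule K (Fin n → K),
        (∀ j, ∀ v ∈ V, (A j).mulVecLin v ∈ V) →
        (∀ j, ∀ v ∈ V, (B j).mulVecLin v ∈ V) →
        (∀ i, ∀ v ∈ V, (X i).mulVecLin v ∈ V) →
        V = ⊥ ∨ V = ⊤) ∧
    (∀ h : GL (Fin n) K,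
        (∀ j, (h : Matrix (Fin n) (Fin n) K) * A j *
            ((h⁻¹ : GL (Fin n) K) : Matrix (Fin n) (Fin n) K) = A j) →
        (∀ j, (h : Matrix (Fin n) (Fin n) K) * B j *
            ((h⁻¹ : GL (Fin n) K) : Matrix (Fin n) (Fin n) K) = B j) →
        (∀ i, (h : Matrix (Fin n) (Fin n) K) * X i *
            ((h⁻¹ : GL (Fin n) K) : Matrix (Fin n) (Fin n) K) = X i) →
        ∃ c : K, (h : Matrix (Fin n) (Fin n) K) = c • (1 : Matrix (Fin n) (Fin n) K)) := by
  have hirr : ∀ V : Submodule K (Fin n → K),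
      (∀ j, ∀ v ∈ V, (A j).mulVecLin v ∈ V) →
      (∀ j, ∀ v ∈ V, (B j).mulVecLin v ∈ V) →
      (∀ i, ∀ v ∈ V, (X i).mulVecLin v ∈ V) →
      V = ⊥ ∨ V = ⊤ := fun V hA hB hV => by
    refine hgen V X hX hV
      (LinearMap.sum_trace_restrict_eq_zero_of_sum_commutator_add_sum_eq_zero
        (A := fun j => (A j).mulVecLin) (B := fun j => (B j).mulVecLin) ?_ V hA hB hV)
    simpa [map_sum, Matrix.toLin'_mul, Matrix.toLin'_apply', Module.End.mul_eq_comp] using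
      congrArg (Matrix.toLin' (R := K)) heq
  refine ⟨hirr, fun h hA hB hX' => ?_⟩
  have : Nonempty (Fin n) := ⟨⟨0, hn⟩⟩
  have hcomm : ∀ M : Matrix (Fin n) (Fin n) K,
      (h : Matrix (Fin n) (Fin n) K) * M * ((h⁻¹ : GL (Fin n) K) : Matrix (Fin n) (Fin n) K) = M →
      Commute (Matrix.toLin' (h : Matrix (Fin n) (Fin n) K)) M.mulVecLin := fun M hM => by
    have hMh : (h : Matrix (Fin n) (Fin n) K) * M = M * h := (Units.mul_inv_eq_iff_eq_mul h).mp hM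
    simpa [Commute, SemiconjBy, Matrix.toLin'_mul, Matrix.toLin'_apply', Module.End.mul_eq_comp] using
      congrArg (Matrix.toLin' (R := K)) hMh
  obtain ⟨c, hc⟩ := Module.End.exists_eq_smul_one_of_forall_commute
    (S := Set.range (fun j => (A j).mulVecLin) ∪ Set.range (fun j => (B j).mulVecLin) ∪
      Set.range (fun i => (X i).mulVecLin))
    (fun V hV => hirr V (fun j => hV _ (.inl (.inl ⟨j, rfl⟩)))
      (fun j => hV _ (.inl (.inr ⟨j, rfl⟩))) (fun i => hV _ (.inr ⟨i, rfl⟩)))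
    (h := Matrix.toLin' (h : Matrix (Fin n) (Fin n) K)) (by
      rintro _ ((⟨j, rfl⟩ | ⟨j, rfl⟩) | ⟨i, rfl⟩)
      exacts [hcomm _ (hA j), hcomm _ (hB j), hcomm _ (hX' i)])
  refine ⟨c, (Matrix.toLin' (R := K)).injective ?_⟩
  rw [hc, map_smul, Matrix.toLin'_one]
  rfl
end

section
/- Let G be a finite group, g ≥ 0, k ≥ 1, and C_1,…,C_k conjugacy classes of G with representatives c_1,…,c_k. Then the number of tuples (x_1,y_1,…,x_g,y_g,z_1,…,z_k) with x_i,y_i ∈ G and z_j ∈ C_j satisfying (x_1,y_1)(x_2,y_2)⋯(x_g,y_g) z_1 z_2 ⋯ z_k = 1, where (x,y) := xyx⁻¹y⁻¹, equals |G|^{2g−1} (∏_{j=1}^k |C_j|) Σ_χ χ(c_1)χ(c_2)⋯χ(c_k)/χ(1)^{2g+k−2}, the sum running over all irreducible complex characters χ of G. -/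
/-- `χ : G → ℂ` is an irreducible character of the finite group `G`: it is the character of
some irreducible (simple) finite-dimensional complex representation of `G`. -/
def IsIrreducibleCharacter (G : Type) [Group G] (χ : G → ℂ) : Prop :=
  ∃ V : FDRep ℂ G, CategoryTheory.Simple V ∧ FDRep.character V = χ

open CategoryTheory Module

/-- **Schur's lemma** in trace form. -/
theorem FDRep.finrank_smul_eq_trace_smul_one {G : Type} [Group G] (V : FDRep ℂ G) [Simple V]
    (T : V →ₗ[ℂ] V) (hT : ∀ g, Commute (V.ρ g) T) :
    (finrank ℂ V : ℂ) • T = LinearMap.trace ℂ V T • 1 := by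
  let f : V ⟶ V := ⟨InducedCategory.homMk (ModuleCat.ofHom T), fun g ↦ by
    ext1
    exact (hT g).eq.symm⟩
  obtain ⟨a, ha⟩ := endomorphism_simple_eq_smul_id ℂ f
  have h : T = a • 1 := (congrArg (fun e : V ⟶ V ↦ e.hom.hom.hom) ha).symm
  rw [h]
  simp [smul_smul, mul_comm]

theorem FDRep.finrank_ne_zero_of_simple {G : Type} [Group G] (V : FDRep ℂ G) [Simple V] :
    (finrank ℂ V : ℂ) ≠ 0 := by
  intro h
  have h0 : Subsingleton V := finrank_zero_iff.mp (by exact_mod_cast h)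
  refine id_nonzero V ?_
  apply Action.hom_ext
  ext x
  exact Subsingleton.elim (α := V) _ _

section Irreducible

variable {G : Type} [Group G] [Fintype G]

theorem FDRep.finrank_smul_sum_class_function (V : FDRep ℂ G) [Simple V] (f : G → ℂ)
    (hf : ∀ g h, f (h * g * h⁻¹) = f g) :
    (finrank ℂ V : ℂ) • ∑ g, f g • V.ρ g⁻¹ = (∑ g, f g * V.character g⁻¹) • 1 := by
  rw [FDRep.finrank_smul_eq_trace_smul_one]
  · simp [FDRep.character]
  · intro h
    rw [commute_iff_eq, Finset.mul_sum, Finset.sum_mul]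
    refine Fintype.sum_equiv (MulAut.conj h).toEquiv _ _ fun g ↦ ?_
    have := hf g h
    simp_all [← map_mul, mul_assoc]

theorem FDRep.finrank_smul_sum_conj (V : FDRep ℂ G) [Simple V] (y : G) :
    (finrank ℂ V : ℂ) • ∑ x, V.ρ (x * y * x⁻¹) = ((Fintype.card G : ℂ) * V.character y) • 1 := by
  rw [FDRep.finrank_smul_eq_trace_smul_one]
  · have h (x : G) : LinearMap.trace ℂ V (V.ρ (x * y * x⁻¹)) = V.character y := V.char_conj y x
    simp_rw [map_sum, h]
    simp
  · intro h
    rw [commute_iff_eq, Finset.mul_sum, Finset.sum_mul]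
    refine Fintype.sum_equiv (Equiv.mulLeft h) _ _ fun g ↦ ?_
    simp [← map_mul, mul_assoc]

omit [Fintype G] in
theorem FDRep.finrank_smul_sum_conjClass (V : FDRep ℂ G) [Simple V] (c : G) (C : Set G)
    (hC : C = {x | IsConj c x}) [Fintype C] :
    (finrank ℂ V : ℂ) • ∑ z : C, V.ρ z = ((Nat.card C : ℂ) * V.character c) • 1 := by
  have hconj (h x : G) : x ∈ C ↔ h * x * h⁻¹ ∈ C := by
    subst hC
    have := (isConj_iff (a := x) (b := h * x * h⁻¹)).mpr ⟨h, rfl⟩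
    exact ⟨fun H ↦ IsConj.trans H this, fun H ↦ IsConj.trans H this.symm⟩
  rw [FDRep.finrank_smul_eq_trace_smul_one]
  · have h (z : C) : LinearMap.trace ℂ V (V.ρ z) = V.character c := by
      obtain ⟨z, hz⟩ := z
      rw [hC] at hz
      obtain ⟨x, rfl⟩ := isConj_iff.mp hz
      exact V.char_conj c x
    simp_rw [map_sum, h]
    simp
  · intro h
    rw [commute_iff_eq, Finset.mul_sum, Finset.sum_mul]
    refine Fintype.sum_equiv ((MulAut.conj h).toEquiv.subtypeEquiv (hconj h)) _ _ fun g ↦ ?_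
    simp [← map_mul, mul_assoc]

theorem FDRep.finrank_sq_smul_sum_commutator (V : FDRep ℂ G) [Simple V] :
    ((finrank ℂ V : ℂ) ^ 2) • ∑ p : G × G, V.ρ (p.1 * p.2 * p.1⁻¹ * p.2⁻¹) =
      ((Fintype.card G : ℂ) ^ 2) • 1 := by
  have h1 : (finrank ℂ V : ℂ) • ∑ p : G × G, V.ρ (p.1 * p.2 * p.1⁻¹ * p.2⁻¹) =
      (Fintype.card G : ℂ) • ∑ y, V.character y • V.ρ y⁻¹ := by
    rw [Fintype.sum_prod_type_right, Finset.smul_sum, Finset.smul_sum]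
    refine Finset.sum_congr rfl fun y _ ↦ ?_
    simp_rw [map_mul V.ρ _ y⁻¹]
    rw [← Finset.sum_mul, ← smul_mul_assoc, V.finrank_smul_sum_conj, smul_mul_assoc, one_mul,
      mul_smul]
  rw [sq, mul_smul, h1, smul_comm, V.finrank_smul_sum_class_function _ fun g h ↦ V.char_conj g h,
    (V.simple_iff_char_is_norm_one).mp inferInstance, smul_smul, sq, Nat.card_eq_fintype_card]

theorem IsIrreducibleCharacter.sum_mul_inv {χ ψ : G → ℂ} [Decidable (χ = ψ)]
    (hχ : IsIrreducibleCharacter G χ) (hψ : IsIrreducibleCharacter G ψ) :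
    ∑ g, χ g * ψ g⁻¹ = if χ = ψ then (Fintype.card G : ℂ) else 0 := by
  obtain ⟨V, _, rfl⟩ := hχ
  obtain ⟨W, _, rfl⟩ := hψ
  split_ifs with h
  · rw [← h, (V.simple_iff_char_is_norm_one).mp inferInstance, Nat.card_eq_fintype_card]
  · have hG : (Nat.card G : ℂ) ≠ 0 := NeZero.ne _
    have := invertibleOfNonzero hG
    have h1 := FDRep.char_orthonormal V W
    rw [if_neg fun ⟨i⟩ ↦ h (FDRep.char_iso i)] at h1
    simpa [hG] using h1

theorem finite_setOf_isIrreducibleCharacter :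
    {χ : G → ℂ | IsIrreducibleCharacter G χ}.Finite := by
  classical
  have h : LinearIndependent ℂ (Subtype.val : {χ : G → ℂ | IsIrreducibleCharacter G χ} → G → ℂ) := by
    rw [linearIndependent_iff']
    intro s a ha ψ hψ
    have h1 : ∑ g, (∑ χ ∈ s, a χ • (χ : G → ℂ)) g * ψ.1 g⁻¹ = a ψ * Fintype.card G := by
      simp_rw [Finset.sum_apply, Pi.smul_apply, smul_eq_mul, Finset.sum_mul, mul_assoc]
      rw [Finset.sum_comm]
      simp_rw [← Finset.mul_sum, fun χ : {χ : G → ℂ | IsIrreducibleCharacter G χ} ↦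
        IsIrreducibleCharacter.sum_mul_inv χ.2 ψ.2, Subtype.val_inj]
      simp [hψ]
    rw [ha] at h1
    simpa using h1
  exact h.setFinite

open scoped MonoidAlgebra in
theorem sum_class_function_smul_eq_zero (f : G → ℂ) (hf : ∀ g h, f (h * g * h⁻¹) = f g)
    (h0 : ∀ χ, IsIrreducibleCharacter G χ → ∑ g, f g * χ g⁻¹ = 0)
    (M : Type) [AddCommGroup M] [Module ℂ M] [Module ℂ[G] M] [IsScalarTower ℂ ℂ[G] M]
    [IsSimpleModule ℂ[G] M] (m : M) :
    (∑ g, MonoidAlgebra.single g⁻¹ (f g) : ℂ[G]) • m = 0 := by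
  let ρ : Representation ℂ G M := Representation.ofModule' M
  have hρ (b : ℂ[G]) (x : M) : ρ.asAlgebraHom b x = b • x := by
    simp [ρ, Representation.asAlgebraHom_def, Representation.ofModule']
  have : Module.Finite ℂ M := Module.Finite.trans ℂ[G] M
  let e : ρ.asModule ≃ₗ[ℂ[G]] M := { ρ.asModuleEquiv with map_smul' := hρ }
  have hirr : ρ.IsIrreducible :=
    (Representation.irreducible_iff_isSimpleModule_asModule ρ).mpr (IsSimpleModule.congr e)
  have : Simple (FDRep.of ρ) := by
    rw [FDRep.simple_iff_char_is_norm_one]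
    have hG : (Nat.card G : ℂ) ≠ 0 := NeZero.ne _
    have := invertibleOfNonzero hG
    have h1 := Representation.char_orthonormal ρ ρ
    rw [if_pos ⟨Representation.Equiv.refl ρ⟩, inv_mul_eq_one₀ hG] at h1
    exact h1.symm
  have h1 := (FDRep.of ρ).finrank_smul_sum_class_function f hf
  rw [h0 _ ⟨_, this, rfl⟩, zero_smul,
    smul_eq_zero_iff_right (FDRep.of ρ).finrank_ne_zero_of_simple] at h1
  have h2 : ρ.asAlgebraHom (∑ g, MonoidAlgebra.single g⁻¹ (f g)) = 0 := by
    rw [← h1]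
    simp
  rw [← hρ, h2, LinearMap.zero_apply]

open scoped MonoidAlgebra in
/-- A class function orthogonal to every irreducible character vanishes. -/
theorem eq_zero_of_sum_mul_irreducible_eq_zero (f : G → ℂ)
    (hf : ∀ g h, f (h * g * h⁻¹) = f g)
    (h0 : ∀ χ, IsIrreducibleCharacter G χ → ∑ g, f g * χ g⁻¹ = 0) : f = 0 := by
  classical
  let a : ℂ[G] := ∑ g, MonoidAlgebra.single g⁻¹ (f g)
  have htop (m : ℂ[G]) : a * m = 0 := by
    have hm : m ∈ sSup {S : Submodule ℂ[G] ℂ[G] | IsSimpleModule ℂ[G] S} := by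
      rw [IsSemisimpleModule.sSup_simples_eq_top]
      trivial
    rw [sSup_eq_iSup'] at hm
    induction hm using Submodule.iSup_induction' with
    | mem S x hx =>
      have : IsSimpleModule ℂ[G] S.1 := S.2
      exact congrArg Subtype.val (sum_class_function_smul_eq_zero f hf h0 S.1 ⟨x, hx⟩)
    | zero => exact mul_zero a
    | add x y _ _ hx hy => rw [mul_add, hx, hy, add_zero]
  have ha : a = 0 := by simpa using htop 1
  funext g
  have := congrArg (fun b : ℂ[G] ↦ b.coeff g⁻¹) ha
  simpa [a, MonoidAlgebra.coeff_single, Finsupp.single_apply] using this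

theorem sum_irreducible_apply_one_mul [DecidableEq G] (g : G) :
    ∑ χ ∈ (finite_setOf_isIrreducibleCharacter (G := G)).toFinset, χ 1 * χ g =
      if g = 1 then (Fintype.card G : ℂ) else 0 := by
  classical
  let f : G → ℂ := fun g ↦ (if g = 1 then (Fintype.card G : ℂ) else 0) -
    ∑ χ ∈ (finite_setOf_isIrreducibleCharacter (G := G)).toFinset, χ 1 * χ g
  have hf : f = 0 := by
    refine eq_zero_of_sum_mul_irreducible_eq_zero f (fun g h ↦ ?_) fun ψ hψ ↦ ?_
    · simp only [f, conj_eq_one_iff]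
      congr 1
      refine Finset.sum_congr rfl fun χ hχ ↦ ?_
      obtain ⟨V, _, rfl⟩ := (Set.Finite.mem_toFinset _).mp hχ
      rw [V.char_conj]
    · simp_rw [f, sub_mul, Finset.sum_sub_distrib, Finset.sum_mul, mul_assoc]
      rw [Finset.sum_comm]
      simp_rw [← Finset.mul_sum]
      have hsum : ∀ χ ∈ (finite_setOf_isIrreducibleCharacter (G := G)).toFinset,
          χ 1 * ∑ g, χ g * ψ g⁻¹ = χ 1 * if χ = ψ then (Fintype.card G : ℂ) else 0 := by
        intro χ hχ
        have hχ' : IsIrreducibleCharacter G χ :=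
          finite_setOf_isIrreducibleCharacter.mem_toFinset.mp hχ
        rw [hχ'.sum_mul_inv hψ]
      rw [Finset.sum_congr rfl hsum]
      simp [hψ, mul_comm]
  exact (sub_eq_zero.mp (congrFun hf g)).symm

end Irreducible

theorem List.prod_ofFn_sum {A : Type*} [Semiring A] {n : ℕ} {S : Fin n → Type*}
    [∀ i, Fintype (S i)] (F : ∀ i, S i → A) :
    ∑ t : ∀ i, S i, (List.ofFn fun i ↦ F i (t i)).prod =
      (List.ofFn fun i ↦ ∑ s, F i s).prod := by
  induction n with
  | zero => simp
  | succ n ih =>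
    rw [← (Fin.consEquiv S).sum_comp, Fintype.sum_prod_type]
    simp [List.ofFn_succ, ← Finset.mul_sum, ih fun i ↦ F i.succ, Finset.sum_mul]

theorem List.prod_ofFn_smul_one {A : Type*} [Ring A] [Algebra ℂ A] {n : ℕ} (a : Fin n → ℂ) :
    (List.ofFn fun i ↦ a i • (1 : A)).prod = (∏ i, a i) • 1 := by
  induction n with
  | zero => simp
  | succ n ih => simp [List.ofFn_succ, ih, Fin.prod_univ_succ, smul_smul, mul_comm]

theorem FDRep.sum_char_commutators_mul_conjClasses {G : Type} [Group G] [Fintype G] {g k : ℕ}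
    (V : FDRep ℂ G) [Simple V] (C : Fin k → Set G) (c : Fin k → G)
    (hC : ∀ j, C j = {x | IsConj (c j) x}) [∀ j, Fintype (C j)] :
    ∑ t : (Fin g → G × G) × (∀ j, C j),
        V.character ((List.ofFn fun i ↦
          (t.1 i).1 * (t.1 i).2 * (t.1 i).1⁻¹ * (t.1 i).2⁻¹).prod *
            (List.ofFn fun j ↦ (t.2 j : G)).prod) =
      ((Fintype.card G : ℂ) ^ 2 / (finrank ℂ V : ℂ) ^ 2) ^ g *
        (∏ j, (Nat.card (C j) : ℂ) * V.character (c j) / finrank ℂ V) * finrank ℂ V := by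
  have hn := V.finrank_ne_zero_of_simple
  have h1 : ∑ p : G × G, V.ρ (p.1 * p.2 * p.1⁻¹ * p.2⁻¹) =
      ((Fintype.card G : ℂ) ^ 2 / (finrank ℂ V : ℂ) ^ 2) • 1 := by
    rw [div_eq_inv_mul, mul_smul, ← V.finrank_sq_smul_sum_commutator,
      inv_smul_smul₀ (pow_ne_zero 2 hn)]
  have h2 (j : Fin k) : ∑ z : C j, V.ρ z =
      ((Nat.card (C j) : ℂ) * V.character (c j) / finrank ℂ V) • 1 := by
    rw [div_eq_inv_mul, mul_smul, ← V.finrank_smul_sum_conjClass (c j) (C j) (hC j),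
      inv_smul_smul₀ hn]
  have h3 := List.prod_ofFn_sum (S := fun _ : Fin g ↦ G × G)
    (fun _ p ↦ V.ρ (p.1 * p.2 * p.1⁻¹ * p.2⁻¹))
  have h4 := List.prod_ofFn_sum (S := fun j ↦ C j) (fun _ z ↦ V.ρ z)
  simp_rw [h1] at h3
  simp_rw [h2] at h4
  rw [List.prod_ofFn_smul_one, Finset.prod_const, Finset.card_univ, Fintype.card_fin] at h3
  rw [List.prod_ofFn_smul_one] at h4
  have h5 := congrArg (LinearMap.trace ℂ V) (congrArg₂ (· * ·) h3 h4)
  simp_rw [Finset.sum_mul_sum, ← Fintype.sum_prod_type', map_sum] at h5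
  rw [smul_mul_smul_comm, one_mul, map_smul, LinearMap.trace_one, smul_eq_mul] at h5
  rw [← h5]
  refine Finset.sum_congr rfl fun t _ ↦ ?_
  rw [FDRep.character, map_mul, map_list_prod, map_list_prod, List.map_ofFn, List.map_ofFn]
  rfl

theorem IsIrreducibleCharacter.apply_one_mul_sum {G : Type} [Group G] [Fintype G] {g k : ℕ}
    {χ : G → ℂ} (hχ : IsIrreducibleCharacter G χ) (C : Fin k → Set G) (c : Fin k → G)
    (hC : ∀ j, C j = {x | IsConj (c j) x}) [∀ j, Fintype (C j)] :
    ∑ t : (Fin g → G × G) × (∀ j, C j),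
        χ 1 * χ ((List.ofFn fun i ↦ (t.1 i).1 * (t.1 i).2 * (t.1 i).1⁻¹ * (t.1 i).2⁻¹).prod *
            (List.ofFn fun j ↦ (t.2 j : G)).prod) =
      (Fintype.card G : ℂ) ^ (2 * (g : ℤ)) * (∏ j, (Nat.card (C j) : ℂ)) *
        ((∏ j, χ (c j)) / χ 1 ^ (2 * (g : ℤ) + (k : ℤ) - 2)) := by
  obtain ⟨V, _, rfl⟩ := hχ
  have hn := V.finrank_ne_zero_of_simple
  rw [← Finset.mul_sum, V.sum_char_commutators_mul_conjClasses C c hC, V.char_one,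
    zpow_sub₀ hn, zpow_add₀ hn, zpow_mul, zpow_mul, Finset.prod_div_distrib,
    Finset.prod_mul_distrib, Finset.prod_const, Finset.card_univ, Fintype.card_fin]
  simp only [zpow_natCast, zpow_ofNat, div_pow]
  field_simp

/-- Tuples in a product of sets, with the two families of entries of the commutators paired up. -/
def surfaceTuplesEquiv {G : Type} [Group G] (g k : ℕ) (C : Fin k → Set G) :
    {t : (Fin g → G) × (Fin g → G) × (Fin k → G) //
        (∀ j, t.2.2 j ∈ C j) ∧
        (List.ofFn (fun i => t.1 i * t.2.1 i * (t.1 i)⁻¹ * (t.2.1 i)⁻¹)).prod *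
          (List.ofFn t.2.2).prod = 1} ≃
    {t : (Fin g → G × G) × (∀ j, C j) //
        (List.ofFn fun i ↦ (t.1 i).1 * (t.1 i).2 * (t.1 i).1⁻¹ * (t.1 i).2⁻¹).prod *
            (List.ofFn fun j ↦ (t.2 j : G)).prod = 1} where
  toFun t := ⟨(fun i ↦ (t.1.1 i, t.1.2.1 i), fun j ↦ ⟨t.1.2.2 j, t.2.1 j⟩), t.2.2⟩
  invFun t := ⟨(fun i ↦ (t.1.1 i).1, fun i ↦ (t.1.1 i).2, fun j ↦ t.1.2 j),
    fun j ↦ (t.1.2 j).2, t.2⟩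
  left_inv _ := rfl
  right_inv _ := rfl

/-- **Frobenius-type mass formula** (Proposition 3.1.6). For conjugacy classes
`C_1, …, C_k` of a finite group `G` with representatives `c_1, …, c_k`, the number of tuples
`(x_1, y_1, …, x_g, y_g, z_1, …, z_k)` with `z_j ∈ C_j` and
`(x_1,y_1) ⋯ (x_g,y_g) z_1 ⋯ z_k = 1` equals
`|G|^{2g-1} ∏_j |C_j| ∑_χ ∏_j χ(c_j) / χ(1)^{2g+k-2}`, the sum being over the irreducible
complex characters of `G`. -/
theorem frobenius_mass_formula
    (G : Type) [Group G] [Fintype G]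
    (g k : ℕ) (hk : 1 ≤ k)
    (C : Fin k → Set G) (c : Fin k → G)
    (hC : ∀ j, C j = {x | IsConj (c j) x}) :
    (Nat.card {t : (Fin g → G) × (Fin g → G) × (Fin k → G) //
        (∀ j, t.2.2 j ∈ C j) ∧
        (List.ofFn (fun i => t.1 i * t.2.1 i * (t.1 i)⁻¹ * (t.2.1 i)⁻¹)).prod *
          (List.ofFn t.2.2).prod = 1} : ℂ)
      = (Fintype.card G : ℂ) ^ (2 * (g : ℤ) - 1) *
        (∏ j, (Nat.card (C j) : ℂ)) *
        ∑ᶠ χ ∈ {χ : G → ℂ | IsIrreducibleCharacter G χ},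
          (∏ j, χ (c j)) / (χ 1) ^ (2 * (g : ℤ) + (k : ℤ) - 2) := by
  classical
  have hG : (Fintype.card G : ℂ) ≠ 0 := NeZero.ne _
  rw [Nat.card_congr (surfaceTuplesEquiv g k C), Nat.card_eq_fintype_card, Fintype.card_subtype,
    Finset.natCast_card_filter, finsum_mem_eq_finite_toFinset_sum _
      finite_setOf_isIrreducibleCharacter, zpow_sub₀ hG, zpow_one, div_mul_eq_mul_div,
    div_mul_eq_mul_div, eq_div_iff hG, Finset.sum_mul, Finset.mul_sum]
  simp_rw [ite_mul, one_mul, zero_mul, ← sum_irreducible_apply_one_mul]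
  rw [Finset.sum_comm]
  refine Finset.sum_congr rfl fun χ hχ ↦ ?_
  have hχ' : IsIrreducibleCharacter G χ :=
    finite_setOf_isIrreducibleCharacter.mem_toFinset.mp hχ
  rw [hχ'.apply_one_mul_sum C c hC]
end

section
/- Let F_q be a finite field, Ψ: (F_q,+) → ℂ^× a nontrivial additive character, g ≥ 0, and let O_1,…,O_k be orbits of the conjugation action of GL_n(F_q) on gl_n(F_q). Then the number of tuples (A_1,B_1,…,A_g,B_g,X_1,…,X_k) with A_i,B_i ∈ gl_n(F_q), X_j ∈ O_j and [A_1,B_1]+⋯+[A_g,B_g]+X_1+⋯+X_k = 0, where [A,B] := AB − BA, equals q^{n²(g−1)} Σ_{x ∈ gl_n(F_q)} |C(x)|^g ∏_{j=1}^k ( Σ_{z ∈ O_j} Ψ(Tr(xz)) ), where C(x) = {y ∈ gl_n(F_q) : xy = yx} is the centralizer of x. -/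
open Matrix

section FourierCount

variable {F : Type*} [Field F] [Fintype F] {m : Type*} [Fintype m] [DecidableEq m]

/-- An additive character maps finite sums to products. -/
theorem AddChar.map_sum_eq_prod {A M ι : Type*} [AddCommMonoid A] [CommMonoid M]
    (ψ : AddChar A M) (s : Finset ι) (f : ι → A) : ψ (∑ i ∈ s, f i) = ∏ i ∈ s, ψ (f i) :=
  map_prod ψ.toMonoidHom (fun i => Multiplicative.ofAdd (f i)) s

open Classical in
/-- Orthogonality of the characters `y ↦ ψ (tr (x * y))` of the matrix algebra. -/
theorem AddChar.sum_trace_mul {ψ : AddChar F ℂ} (hψ : ψ ≠ 1) (y : Matrix m m F) :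
    ∑ x : Matrix m m F, ψ (trace (x * y)) =
      if y = 0 then (Fintype.card F : ℂ) ^ (Fintype.card m ^ 2) else 0 := by
  split_ifs with hy
  · have hcard : Fintype.card (Matrix m m F) = Fintype.card (m → m → F) :=
      Fintype.card_congr (Equiv.refl _)
    simp [hy, hcard, sq, pow_mul]
  · obtain ⟨i, j, hij⟩ : ∃ i j, y i j ≠ 0 := by
      by_contra! h
      exact hy (Matrix.ext h)
    obtain ⟨a, ha⟩ := AddChar.ne_one_iff.1 hψ
    refine AddChar.sum_eq_zero_of_ne_one
      (ψ := ψ.compAddMonoidHom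
        ((traceAddMonoidHom m F).comp (AddMonoidHom.mulRight y))) ?_
    refine AddChar.ne_one_iff.2 ⟨Matrix.single j i (a / y i j), ?_⟩
    simpa [Matrix.trace_single_mul, div_mul_cancel₀ _ hij] using ha

/-- The sum of `ψ (tr (x * [A, B]))` over all pairs of matrices counts the centralizer of `x`. -/
theorem AddChar.sum_trace_mul_commutator {ψ : AddChar F ℂ} (hψ : ψ ≠ 1) (x : Matrix m m F) :
    ∑ A : Matrix m m F, ∑ B : Matrix m m F, ψ (trace (x * (A * B - B * A))) =
      (Fintype.card F : ℂ) ^ (Fintype.card m ^ 2) *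
        (Nat.card {y : Matrix m m F | x * y = y * x} : ℂ) := by
  classical
  have key (A B : Matrix m m F) :
      trace (x * (A * B - B * A)) = trace (B * (x * A - A * x)) := by
    rw [mul_sub, mul_sub, trace_sub, trace_sub, ← mul_assoc, trace_mul_comm (x * A) B,
      trace_mul_comm x (B * A), mul_assoc B A x]
  simp_rw [key, AddChar.sum_trace_mul hψ, sub_eq_zero, ← Finset.sum_filter, Finset.sum_const,
    nsmul_eq_mul]
  rw [mul_comm, Nat.card_eq_fintype_card, Fintype.card_subtype]
  rfl

open Classical in
/-- Counting the zeros of a matrix-valued function by Fourier inversion. -/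
theorem AddChar.card_mul_card_zeros {ψ : AddChar F ℂ} (hψ : ψ ≠ 1) {T : Type*} [Fintype T]
    (p : T → Prop) (S : T → Matrix m m F) :
    (Fintype.card F : ℂ) ^ (Fintype.card m ^ 2) * (Nat.card {t : T // p t ∧ S t = 0} : ℂ) =
      ∑ x : Matrix m m F, ∑ t, if p t then ψ (trace (x * S t)) else 0 := by
  rw [Finset.sum_comm, Nat.card_eq_fintype_card, Fintype.card_subtype, Finset.card_filter,
    Nat.cast_sum, Finset.mul_sum]
  refine Finset.sum_congr rfl fun t _ => ?_
  by_cases ht : p t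
  · simp [ht, AddChar.sum_trace_mul hψ]
  · simp [ht]

open Classical in
/-- The Fourier transform of the number of solutions factors over the variables. -/
theorem AddChar.sum_trace_mul_quiver (ψ : AddChar F ℂ) {ι κ : Type*} [Fintype ι] [Fintype κ]
    (O : κ → Set (Matrix m m F)) (x : Matrix m m F) :
    ∑ t : (ι → Matrix m m F) × (ι → Matrix m m F) × (κ → Matrix m m F),
      (if ∀ j, t.2.2 j ∈ O j then
        ψ (trace (x * ((∑ i, (t.1 i * t.2.1 i - t.2.1 i * t.1 i)) + ∑ j, t.2.2 j))) else 0) =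
      (∑ A : Matrix m m F, ∑ B : Matrix m m F, ψ (trace (x * (A * B - B * A)))) ^
          Fintype.card ι *
        ∏ j, ∑ z, if z ∈ O j then ψ (trace (x * z)) else 0 := by
  have hpow : (∑ A : Matrix m m F, ∑ B : Matrix m m F, ψ (trace (x * (A * B - B * A)))) ^
      Fintype.card ι = ∑ A : ι → Matrix m m F, ∑ B : ι → Matrix m m F,
        ∏ i, ψ (trace (x * (A i * B i - B i * A i))) := by
    rw [← Finset.card_univ, ← Finset.prod_const, Finset.prod_univ_sum, Fintype.piFinset_univ]
    refine Finset.sum_congr rfl fun A _ => ?_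
    rw [Finset.prod_univ_sum, Fintype.piFinset_univ]
  rw [hpow, Finset.prod_univ_sum, Fintype.piFinset_univ]
  simp_rw [Fintype.sum_prod_type, Finset.sum_mul, Finset.mul_sum]
  refine Finset.sum_congr rfl fun A _ => Finset.sum_congr rfl fun B _ =>
    Finset.sum_congr rfl fun X _ => ?_
  rw [Fintype.prod_ite_zero]
  split_ifs
  · rw [mul_add, trace_add, AddChar.map_add_eq_mul, Finset.mul_sum, Finset.mul_sum, trace_sum,
      trace_sum, AddChar.map_sum_eq_prod, AddChar.map_sum_eq_prod]
  · simp

end FourierCount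

/-- **Counting solutions of the additive (quiver) equation via Fourier transforms**
(formula (1.2.2)/Proposition 3.2.3 specialized to `gl_n(F_q)`). For conjugation orbits
`O_1, …, O_k` of `GL_n(F_q)` on `gl_n(F_q)` and a nontrivial additive character `Ψ` of `F_q`,
the number of tuples `(A_1, B_1, …, A_g, B_g, X_1, …, X_k)` with `X_j ∈ O_j` and
`[A_1,B_1] + ⋯ + [A_g,B_g] + X_1 + ⋯ + X_k = 0` equals
`q^{n²(g-1)} ∑_{x ∈ gl_n(F_q)} |C(x)|^g ∏_j 𝓕(1_{O_j})(x)`, where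
`𝓕(1_O)(x) = ∑_{z ∈ O} Ψ(Tr(xz))` and `C(x)` is the centralizer of `x`. -/
theorem quiver_count_fourier
    (F : Type) [Field F] [Fintype F] (n g k : ℕ)
    (Ψ : AddChar F ℂˣ) (hΨ : ∃ a : F, Ψ a ≠ 1)
    (O : Fin k → Set (Matrix (Fin n) (Fin n) F))
    (hO : ∀ j, ∃ Z : Matrix (Fin n) (Fin n) F,
        O j = {W | ∃ P : GL (Fin n) F,
          W = (P : Matrix (Fin n) (Fin n) F) * Z *
            ((P⁻¹ : GL (Fin n) F) : Matrix (Fin n) (Fin n) F)}) :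
    (Nat.card {t : (Fin g → Matrix (Fin n) (Fin n) F) × (Fin g → Matrix (Fin n) (Fin n) F) ×
          (Fin k → Matrix (Fin n) (Fin n) F) //
        (∀ j, t.2.2 j ∈ O j) ∧
        (∑ i, (t.1 i * t.2.1 i - t.2.1 i * t.1 i)) + ∑ j, t.2.2 j = 0} : ℂ)
      = (Fintype.card F : ℂ) ^ ((n ^ 2 : ℤ) * ((g : ℤ) - 1)) *
        ∑ x : Matrix (Fin n) (Fin n) F,
          (Nat.card {y : Matrix (Fin n) (Fin n) F | x * y = y * x} : ℂ) ^ g *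
          ∏ j, ∑ᶠ z ∈ O j, ((Ψ (Matrix.trace (x * z)) : ℂˣ) : ℂ) := by
  classical
  set ψ : AddChar F ℂ := (Units.coeHom ℂ).compAddChar Ψ with hψdef
  have hψ : ψ ≠ 1 := by
    obtain ⟨a, ha⟩ := hΨ
    exact AddChar.ne_one_iff.2 ⟨a, by simpa [hψdef] using ha⟩
  set q : ℂ := (Fintype.card F : ℂ)
  have hq : q ≠ 0 := by simp [q]
  have hfourier (x : Matrix (Fin n) (Fin n) F) (j : Fin k) :
      ∑ᶠ z ∈ O j, ((Ψ (Matrix.trace (x * z)) : ℂˣ) : ℂ) =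
        ∑ z, if z ∈ O j then ψ (trace (x * z)) else 0 := by
    rw [finsum_mem_def, finsum_eq_sum_of_fintype]
    exact Finset.sum_congr rfl fun z _ => Set.indicator_apply _ _ _
  have hscaled : q ^ (n ^ 2) * (Nat.card {t : (Fin g → Matrix (Fin n) (Fin n) F) ×
        (Fin g → Matrix (Fin n) (Fin n) F) × (Fin k → Matrix (Fin n) (Fin n) F) //
        (∀ j, t.2.2 j ∈ O j) ∧
        (∑ i, (t.1 i * t.2.1 i - t.2.1 i * t.1 i)) + ∑ j, t.2.2 j = 0} : ℂ) =
      ∑ x : Matrix (Fin n) (Fin n) F,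
        (q ^ (n ^ 2) * (Nat.card {y : Matrix (Fin n) (Fin n) F | x * y = y * x} : ℂ)) ^ g *
          ∏ j, ∑ z, if z ∈ O j then ψ (trace (x * z)) else 0 := by
    have h (x : Matrix (Fin n) (Fin n) F) :=
      AddChar.sum_trace_mul_quiver (ι := Fin g) ψ O x
    simp only [AddChar.sum_trace_mul_commutator hψ, Fintype.card_fin] at h
    have hcount := AddChar.card_mul_card_zeros hψ
      (T := (Fin g → Matrix (Fin n) (Fin n) F) × (Fin g → Matrix (Fin n) (Fin n) F) ×
        (Fin k → Matrix (Fin n) (Fin n) F)) (fun t => ∀ j, t.2.2 j ∈ O j)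
      (fun t => (∑ i, (t.1 i * t.2.1 i - t.2.1 i * t.1 i)) + ∑ j, t.2.2 j)
    rw [Fintype.card_fin] at hcount
    exact hcount.trans (Finset.sum_congr rfl fun x _ => by convert h x)
  refine mul_left_cancel₀ (pow_ne_zero (n ^ 2) hq) (hscaled.trans ?_)
  have hexp : q ^ (n ^ 2) * q ^ ((n ^ 2 : ℤ) * ((g : ℤ) - 1)) = (q ^ (n ^ 2)) ^ g := by
    rw [← pow_mul, ← zpow_natCast, ← zpow_natCast, ← zpow_add₀ hq]
    congr 1
    push_cast
    ring
  rw [← mul_assoc, hexp, Finset.mul_sum]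
  simp_rw [hfourier, mul_pow, mul_assoc]
end

section
/- Let F_q be a finite field, A = gl_n(F_q), and G = GL_n(F_q) acting on A by conjugation; let G act on the character group X = Hom((A,+), ℂ^×) by (h·φ)(a) = φ(h⁻¹ah). For φ ∈ X put c(φ) := |{y ∈ A : φ(xy − yx) = 1 for all x ∈ A}|. Then: (i) c(φ) depends only on the G-orbit of φ; (ii) for any G-orbits O_1,…,O_k in A with chosen representatives z_j ∈ O_j, the number of tuples (x_1,y_1,…,x_g,y_g,w_1,…,w_k) with x_i,y_i ∈ A, w_j ∈ O_j and [x_1,y_1]+⋯+[x_g,y_g]+w_1+⋯+w_k = 0, where [x,y] := xy − yx, equals Σ_𝒳 (χ_𝒳(0)/|A|) · (|A|·c(𝒳))^g · ∏_{j=1}^k |O_j| χ_𝒳(z_j)/χ_𝒳(0), the sum running over all G-orbits 𝒳 ⊆ X, where χ_𝒳 := Σ_{φ∈𝒳} φ (so χ_𝒳(0) = |𝒳| and χ_𝒳 is constant on G-orbits of A) and c(𝒳) is the common value of c on 𝒳. -/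
open Matrix

variable (F : Type) [Field F] [Fintype F] (n : ℕ)

/-- Conjugation by `h ∈ GL_n(F)` as an additive group homomorphism of `gl_n(F)`,
`a ↦ h⁻¹ a h`. -/
def conjAddHom (h : GL (Fin n) F) :
    Matrix (Fin n) (Fin n) F →+ Matrix (Fin n) (Fin n) F :=
  AddMonoidHom.mk'
    (fun a => ((h⁻¹ : GL (Fin n) F) : Matrix (Fin n) (Fin n) F) * a *
      (h : Matrix (Fin n) (Fin n) F))
    (fun a b => by noncomm_ring)

/-- The action of `h ∈ GL_n(F)` on additive characters of `gl_n(F)`: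
`(h · φ)(a) = φ(h⁻¹ a h)`. -/
def conjAddChar (h : GL (Fin n) F) (φ : AddChar (Matrix (Fin n) (Fin n) F) ℂˣ) :
    AddChar (Matrix (Fin n) (Fin n) F) ℂˣ :=
  φ.compAddMonoidHom (conjAddHom F n h)

/-- A `GL_n(F)`-orbit of additive characters of `gl_n(F)`. -/
def IsCharOrbit (𝒳 : Set (AddChar (Matrix (Fin n) (Fin n) F) ℂˣ)) : Prop :=
  ∃ φ : AddChar (Matrix (Fin n) (Fin n) F) ℂˣ,
    𝒳 = {ψ | ∃ h : GL (Fin n) F, ψ = conjAddChar F n h φ}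

/-- For `φ : gl_n(F) → ℂˣ`, the cardinality `c(φ)` of the set of `y` such that the character
`x ↦ φ(xy - yx)` is trivial. -/
noncomputable def cChar (φ : Matrix (Fin n) (Fin n) F → ℂˣ) : ℕ :=
  Nat.card {y : Matrix (Fin n) (Fin n) F |
    ∀ x : Matrix (Fin n) (Fin n) F, φ (x * y - y * x) = 1}

/-- The `G`-invariant character `χ_𝒳 = ∑_{φ ∈ 𝒳} φ` of `(gl_n(F), +)` attached to an orbit
`𝒳` of additive characters, evaluated at `a`. -/
noncomputable def sumChar (𝒳 : Set (AddChar (Matrix (Fin n) (Fin n) F) ℂˣ))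
    (a : Matrix (Fin n) (Fin n) F) : ℂ :=
  ∑ᶠ φ ∈ 𝒳, ((φ a : ℂˣ) : ℂ)

/-- Additive characters with values in `ℂˣ` are the same as additive characters with values
in `ℂ`. -/
noncomputable def addCharUnitsEquiv (A : Type*) [AddCommGroup A] :
    AddChar A ℂˣ ≃ AddChar A ℂ where
  toFun φ := (Units.coeHom ℂ).compAddChar φ
  invFun ψ := AddChar.toMonoidHomEquiv.symm ψ.toMonoidHom.toHomUnits
  left_inv φ := by ext a; rfl
  right_inv ψ := by ext a; rfl

instance finite_addChar_units (A : Type*) [AddCommGroup A] [Finite A] :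
    Finite (AddChar A ℂˣ) :=
  Finite.of_equiv _ (addCharUnitsEquiv A).symm

noncomputable instance fintype_addChar_units (A : Type*) [AddCommGroup A] [Finite A] :
    Fintype (AddChar A ℂˣ) :=
  Fintype.ofFinite _

open Classical in
lemma sum_addChar_units_apply {A : Type*} [AddCommGroup A] [Fintype A] (a : A) :
    ∑ φ : AddChar A ℂˣ, ((φ a : ℂˣ) : ℂ) = if a = 0 then (Fintype.card A : ℂ) else 0 := by
  rw [← AddChar.sum_apply_eq_ite a]
  exact Fintype.sum_equiv (addCharUnitsEquiv A) _ _ fun _ => rfl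

lemma sum_addChar_units {A : Type*} [AddCommGroup A] [Fintype A] (φ : AddChar A ℂˣ)
    [Decidable (∀ a, φ a = 1)] :
    ∑ a, ((φ a : ℂˣ) : ℂ) = if ∀ a, φ a = 1 then (Fintype.card A : ℂ) else 0 := by
  classical
  refine (AddChar.sum_eq_ite (addCharUnitsEquiv A φ)).trans (if_congr ?_ rfl rfl)
  simp only [AddChar.ext_iff, AddChar.zero_apply]
  exact forall_congr' fun a => Units.val_eq_one

lemma addChar_units_coe_sum {A ι : Type*} [AddCommGroup A] (φ : AddChar A ℂˣ) (s : Finset ι)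
    (f : ι → A) : ((φ (∑ i ∈ s, f i) : ℂˣ) : ℂ) = ∏ i ∈ s, ((φ (f i) : ℂˣ) : ℂ) := by
  exact (congrArg Units.val (map_prod φ.toMonoidHom (fun i => Multiplicative.ofAdd (f i)) s)).trans
    (Units.coe_prod _ _)

/-- The number of solutions of `∑ i, f i (x i) + ∑ j, w j = 0` with `w j ∈ O j` as a sum over
characters. -/
lemma card_solutions_mul_card {A B ι κ : Type*} [AddCommGroup A] [Fintype A] [Fintype B]
    [Fintype ι] [Fintype κ] (f : B → B → A) (O : κ → Set A)
    [∀ j, Fintype (O j)] :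
    (Nat.card {t : (ι → B) × (ι → B) × (κ → A) //
        (∀ j, t.2.2 j ∈ O j) ∧ (∑ i, f (t.1 i) (t.2.1 i)) + ∑ j, t.2.2 j = 0} : ℂ) *
        Fintype.card A =
      ∑ φ : AddChar A ℂˣ, (∑ x, ∑ y, ((φ (f x y) : ℂˣ) : ℂ)) ^ Fintype.card ι *
        ∏ j, ∑ w : O j, ((φ w : ℂˣ) : ℂ) := by
  classical
  have h1 (φ : AddChar A ℂˣ) :
      (∑ x, ∑ y, ((φ (f x y) : ℂˣ) : ℂ)) ^ Fintype.card ι * ∏ j, ∑ w : O j, ((φ w : ℂˣ) : ℂ) =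
        ∑ u : (ι → B × B) × (∀ j, O j),
          ((φ (∑ i, f (u.1 i).1 (u.1 i).2 + ∑ j, (u.2 j : A)) : ℂˣ) : ℂ) := by
    simp only [AddChar.map_add_eq_mul, Units.val_mul, addChar_units_coe_sum]
    rw [Fintype.sum_prod_type, ← Fintype.sum_prod_type', ← Finset.card_univ,
      ← Finset.prod_const, Fintype.prod_sum, Fintype.prod_sum, Finset.sum_mul_sum]
  simp only [h1]
  rw [Finset.sum_comm]
  simp only [sum_addChar_units_apply]
  rw [← Finset.sum_filter, Finset.sum_const, nsmul_eq_mul, ← Fintype.card_subtype,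
    ← Nat.card_eq_fintype_card (α := {u // _})]
  refine congrArg (fun m : ℕ => (m : ℂ) * Fintype.card A) (Nat.card_congr ?_)
  exact
    { toFun := fun t => ⟨⟨fun i => (t.1.1 i, t.1.2.1 i), fun j => ⟨t.1.2.2 j, t.2.1 j⟩⟩, t.2.2⟩
      invFun := fun u => ⟨⟨fun i => (u.1.1 i).1, fun i => (u.1.1 i).2, fun j => u.1.2 j⟩,
        fun j => (u.1.2 j).2, u.2⟩
      left_inv := fun _ => rfl
      right_inv := fun _ => rfl }

set_option linter.unusedSectionVars false

lemma conjAddChar_apply (h : GL (Fin n) F) (φ : AddChar (Matrix (Fin n) (Fin n) F) ℂˣ)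
    (a : Matrix (Fin n) (Fin n) F) :
    conjAddChar F n h φ a = φ ((h⁻¹ : GL (Fin n) F) * a * (h : Matrix (Fin n) (Fin n) F)) :=
  rfl

lemma conjAddChar_one (φ : AddChar (Matrix (Fin n) (Fin n) F) ℂˣ) :
    conjAddChar F n 1 φ = φ := by
  ext a; simp [conjAddChar_apply]

lemma conjAddChar_mul (h k : GL (Fin n) F) (φ : AddChar (Matrix (Fin n) (Fin n) F) ℂˣ) :
    conjAddChar F n (h * k) φ = conjAddChar F n h (conjAddChar F n k φ) := by
  ext a; simp only [conjAddChar_apply, _root_.mul_inv_rev, Units.val_mul, mul_assoc]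

/-- Conjugation `a ↦ h⁻¹ a h` as a permutation of `gl_n(F)`. -/
def conjMatrixEquiv (h : GL (Fin n) F) :
    Matrix (Fin n) (Fin n) F ≃ Matrix (Fin n) (Fin n) F where
  toFun a := (h⁻¹ : GL (Fin n) F) * a * (h : Matrix (Fin n) (Fin n) F)
  invFun a := (h : Matrix (Fin n) (Fin n) F) * a * (h⁻¹ : GL (Fin n) F)
  left_inv a := by simp [mul_assoc]
  right_inv a := by simp [mul_assoc]

lemma conjMatrixEquiv_commutator (h : GL (Fin n) F) (x y : Matrix (Fin n) (Fin n) F) :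
    (h⁻¹ : GL (Fin n) F) * (x * y - y * x) * (h : Matrix (Fin n) (Fin n) F) =
      conjMatrixEquiv F n h x * conjMatrixEquiv F n h y -
        conjMatrixEquiv F n h y * conjMatrixEquiv F n h x := by
  simp [conjMatrixEquiv, mul_assoc, mul_sub, sub_mul]

lemma cChar_conjAddChar (φ : AddChar (Matrix (Fin n) (Fin n) F) ℂˣ) (h : GL (Fin n) F) :
    cChar F n (conjAddChar F n h φ) = cChar F n φ := by
  refine Nat.card_congr ((conjMatrixEquiv F n h).subtypeEquiv fun y => ?_)
  simp only [Set.mem_ofPred_eq, conjAddChar_apply, conjMatrixEquiv_commutator]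
  exact (conjMatrixEquiv F n h).forall_congr_left.trans (by simp)

lemma sum_commutator_addChar (φ : AddChar (Matrix (Fin n) (Fin n) F) ℂˣ) :
    ∑ x, ∑ y, ((φ (x * y - y * x) : ℂˣ) : ℂ) =
      Fintype.card (Matrix (Fin n) (Fin n) F) * cChar F n φ := by
  classical
  rw [Finset.sum_comm]
  have h (y : Matrix (Fin n) (Fin n) F) : ∑ x, ((φ (x * y - y * x) : ℂˣ) : ℂ) =
      if ∀ x, φ (x * y - y * x) = 1 then
        (Fintype.card (Matrix (Fin n) (Fin n) F) : ℂ) else 0 :=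
    sum_addChar_units (φ.compAddMonoidHom (AddMonoidHom.mulRight y - AddMonoidHom.mulLeft y))
  simp only [h]
  rw [← Finset.sum_filter, Finset.sum_const, nsmul_eq_mul, ← Fintype.card_subtype,
    ← Nat.card_eq_fintype_card, mul_comm]
  rfl

/-- The `GL_n(F)`-orbit of an additive character. -/
def charOrbit (φ : AddChar (Matrix (Fin n) (Fin n) F) ℂˣ) :
    Set (AddChar (Matrix (Fin n) (Fin n) F) ℂˣ) :=
  {ψ | ∃ h : GL (Fin n) F, ψ = conjAddChar F n h φ}

lemma mem_charOrbit_self (φ : AddChar (Matrix (Fin n) (Fin n) F) ℂˣ) :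
    φ ∈ charOrbit F n φ :=
  ⟨1, (conjAddChar_one F n φ).symm⟩

lemma conjAddChar_mem_charOrbit (h : GL (Fin n) F)
    {φ ψ : AddChar (Matrix (Fin n) (Fin n) F) ℂˣ} (hψ : ψ ∈ charOrbit F n φ) :
    conjAddChar F n h ψ ∈ charOrbit F n φ := by
  obtain ⟨k, rfl⟩ := hψ
  exact ⟨h * k, (conjAddChar_mul F n h k φ).symm⟩

lemma charOrbit_eq_iff {φ ψ : AddChar (Matrix (Fin n) (Fin n) F) ℂˣ} :
    charOrbit F n ψ = charOrbit F n φ ↔ ψ ∈ charOrbit F n φ := by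
  refine ⟨fun h => h ▸ mem_charOrbit_self F n ψ, ?_⟩
  rintro ⟨h, rfl⟩
  refine Set.Subset.antisymm ?_ ?_
  · rintro _ ⟨k, rfl⟩
    exact conjAddChar_mem_charOrbit F n k ⟨h, rfl⟩
  · rintro _ ⟨k, rfl⟩
    refine ⟨k * h⁻¹, ?_⟩
    rw [← conjAddChar_mul, inv_mul_cancel_right]

open Classical in
lemma sumChar_eq_sum (𝒳 : Set (AddChar (Matrix (Fin n) (Fin n) F) ℂˣ))
    (a : Matrix (Fin n) (Fin n) F) :
    sumChar F n 𝒳 a = ∑ φ with φ ∈ 𝒳, ((φ a : ℂˣ) : ℂ) := by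
  rw [sumChar, finsum_mem_eq_finite_toFinset_sum _ 𝒳.toFinite]
  exact Finset.sum_congr (by ext; simp) fun _ _ => rfl

lemma sumChar_charOrbit_conj (φ : AddChar (Matrix (Fin n) (Fin n) F) ℂˣ) (P : GL (Fin n) F)
    (a : Matrix (Fin n) (Fin n) F) :
    sumChar F n (charOrbit F n φ) (P * a * (P⁻¹ : GL (Fin n) F)) =
      sumChar F n (charOrbit F n φ) a := by
  classical
  rw [sumChar_eq_sum, sumChar_eq_sum]
  refine Finset.sum_bij' (fun ψ _ => conjAddChar F n P⁻¹ ψ) (fun ψ _ => conjAddChar F n P ψ)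
    ?_ ?_ ?_ ?_ ?_
  · simpa using fun ψ => conjAddChar_mem_charOrbit F n P⁻¹
  · simpa using fun ψ => conjAddChar_mem_charOrbit F n P
  · intro ψ _; rw [← conjAddChar_mul, mul_inv_cancel, conjAddChar_one]
  · intro ψ _; rw [← conjAddChar_mul, inv_mul_cancel, conjAddChar_one]
  · intro ψ _; rw [conjAddChar_apply, inv_inv]

lemma sum_conjClass_conjAddChar {S : Set (Matrix (Fin n) (Fin n) F)} [Fintype S]
    {z : Matrix (Fin n) (Fin n) F}
    (hS : S = {W | ∃ P : GL (Fin n) F, W = P * z * (P⁻¹ : GL (Fin n) F)})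
    (h : GL (Fin n) F) (φ : AddChar (Matrix (Fin n) (Fin n) F) ℂˣ) :
    ∑ w : S, ((conjAddChar F n h φ w : ℂˣ) : ℂ) = ∑ w : S, ((φ w : ℂˣ) : ℂ) := by
  refine Fintype.sum_equiv ((conjMatrixEquiv F n h).subtypeEquiv fun w => ?_) _ _ fun _ => rfl
  subst hS
  constructor
  · rintro ⟨P, rfl⟩
    exact ⟨h⁻¹ * P, by simp [conjMatrixEquiv, mul_assoc]⟩
  · rintro ⟨P, hP⟩
    refine ⟨h * P, (conjMatrixEquiv F n h).injective ?_⟩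
    rw [hP]
    simp [conjMatrixEquiv, mul_assoc]

lemma sum_conjClass_addChar {S : Set (Matrix (Fin n) (Fin n) F)} [Fintype S]
    {z : Matrix (Fin n) (Fin n) F}
    (hS : S = {W | ∃ P : GL (Fin n) F, W = P * z * (P⁻¹ : GL (Fin n) F)})
    (φ : AddChar (Matrix (Fin n) (Fin n) F) ℂˣ) :
    (Nat.card S : ℂ) * sumChar F n (charOrbit F n φ) z / sumChar F n (charOrbit F n φ) 0 =
      ∑ w : S, ((φ w : ℂˣ) : ℂ) := by
  classical
  have hconst (w : S) : sumChar F n (charOrbit F n φ) w = sumChar F n (charOrbit F n φ) z := by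
    obtain ⟨w, hw⟩ := w
    subst hS
    obtain ⟨P, rfl⟩ := hw
    exact sumChar_charOrbit_conj F n φ P z
  have h0 : sumChar F n (charOrbit F n φ) 0 ≠ 0 := by
    rw [sumChar_eq_sum]
    simpa using ⟨φ, mem_charOrbit_self F n φ⟩
  rw [div_eq_iff h0]
  calc (Nat.card S : ℂ) * sumChar F n (charOrbit F n φ) z
      = ∑ w : S, sumChar F n (charOrbit F n φ) w := by simp [hconst]
    _ = ∑ ψ with ψ ∈ charOrbit F n φ, ∑ w : S, ((ψ w : ℂˣ) : ℂ) := by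
        simp only [sumChar_eq_sum]; exact Finset.sum_comm
    _ = ∑ ψ with ψ ∈ charOrbit F n φ, ∑ w : S, ((φ w : ℂˣ) : ℂ) := by
        refine Finset.sum_congr rfl fun ψ hψ => ?_
        obtain ⟨h, rfl⟩ := (Finset.mem_filter.1 hψ).2
        exact sum_conjClass_conjAddChar F n hS h φ
    _ = _ := by simp [sumChar_eq_sum, mul_comm]

/-- **Equivariant Fourier analysis on `gl_n(F_q)`** (Proposition 3.2.3 and the discussion
around it). (i) `c(φ)` is constant on `GL_n(F_q)`-orbits of additive characters of
`gl_n(F_q)`; (ii) for conjugation orbits `O_1, …, O_k` in `gl_n(F_q)` with representatives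
`z_j ∈ O_j`, the number of tuples `(x_1, y_1, …, x_g, y_g, w_1, …, w_k)` with `w_j ∈ O_j` and
`[x_1,y_1] + ⋯ + [x_g,y_g] + w_1 + ⋯ + w_k = 0` equals
`∑_𝒳 (χ_𝒳(0)/|A|) (|A| c(𝒳))^g ∏_j |O_j| χ_𝒳(z_j)/χ_𝒳(0)`, the sum over all
`GL_n(F_q)`-orbits `𝒳` of additive characters, where `χ_𝒳 = ∑_{φ ∈ 𝒳} φ` and `c(𝒳)` is the
common value of `c` on `𝒳`. -/
theorem equivariant_fourier_count
    (g k : ℕ)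
    (O : Fin k → Set (Matrix (Fin n) (Fin n) F)) (z : Fin k → Matrix (Fin n) (Fin n) F)
    (hz : ∀ j, z j ∈ O j)
    (hO : ∀ j, O j = {W | ∃ P : GL (Fin n) F,
        W = (P : Matrix (Fin n) (Fin n) F) * z j *
          ((P⁻¹ : GL (Fin n) F) : Matrix (Fin n) (Fin n) F)})
    (cval : Set (AddChar (Matrix (Fin n) (Fin n) F) ℂˣ) → ℕ)
    (hcval : ∀ 𝒳, IsCharOrbit F n 𝒳 → ∀ φ ∈ 𝒳, cval 𝒳 = cChar F n φ) :
    (∀ (φ : AddChar (Matrix (Fin n) (Fin n) F) ℂˣ) (h : GL (Fin n) F),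
        cChar F n (conjAddChar F n h φ) = cChar F n φ) ∧
    (Nat.card {t : (Fin g → Matrix (Fin n) (Fin n) F) × (Fin g → Matrix (Fin n) (Fin n) F) ×
          (Fin k → Matrix (Fin n) (Fin n) F) //
        (∀ j, t.2.2 j ∈ O j) ∧
        (∑ i, (t.1 i * t.2.1 i - t.2.1 i * t.1 i)) + ∑ j, t.2.2 j = 0} : ℂ)
      = ∑ᶠ 𝒳 ∈ {S : Set (AddChar (Matrix (Fin n) (Fin n) F) ℂˣ) | IsCharOrbit F n S},
          (sumChar F n 𝒳 0 / (Fintype.card (Matrix (Fin n) (Fin n) F) : ℂ)) *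
          ((Fintype.card (Matrix (Fin n) (Fin n) F) : ℂ) * (cval 𝒳 : ℂ)) ^ g *
          ∏ j, (Nat.card (O j) : ℂ) * sumChar F n 𝒳 (z j) / sumChar F n 𝒳 0 := by
  classical
  refine ⟨cChar_conjAddChar F n, ?_⟩
  have hA : (Fintype.card (Matrix (Fin n) (Fin n) F) : ℂ) ≠ 0 :=
    Nat.cast_ne_zero.2 Fintype.card_ne_zero
  have key := card_solutions_mul_card (ι := Fin g) (fun x y => x * y - y * x) O
  simp only [sum_commutator_addChar, Fintype.card_fin] at key
  rw [eq_div_of_mul_eq hA key, Finset.sum_div]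
  have horb : {S | IsCharOrbit F n S} =
      ((Finset.univ.image (charOrbit F n) : Finset _) : Set (Set _)) := by
    ext S
    simp [IsCharOrbit, charOrbit, eq_comm]
  rw [horb, finsum_mem_coe_finset]
  refine (Finset.sum_image' _ fun φ _ => ?_).symm
  simp only [charOrbit_eq_iff, fun j => sum_conjClass_addChar F n (hO j) φ,
    hcval (charOrbit F n φ) ⟨φ, rfl⟩ φ (mem_charOrbit_self F n φ)]
  calc _ = ∑ ψ with ψ ∈ charOrbit F n φ,
        ((Fintype.card (Matrix (Fin n) (Fin n) F) : ℂ) * (cChar F n φ : ℂ)) ^ g *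
          (∏ j, ∑ w : O j, ((φ w : ℂˣ) : ℂ)) / Fintype.card (Matrix (Fin n) (Fin n) F) := by
        rw [Finset.sum_const, nsmul_eq_mul, sumChar_eq_sum]
        simp only [AddChar.map_zero_eq_one, Units.val_one, Finset.sum_const, nsmul_eq_mul]
        ring
    _ = _ := by
        refine Finset.sum_congr rfl fun ψ hψ => ?_
        obtain ⟨h, rfl⟩ := (Finset.mem_filter.1 hψ).2
        simp only [cChar_conjAddChar, fun j => sum_conjClass_conjAddChar F n (hO j) h φ]
end
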